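/- arXiv:1611.01613 — 5 statements merged into one kernel-verified Lean document; each statement's English description precedes it below -/
import Mathlib

section
/- Let M be a smooth finite-dimensional manifold without boundary, n ≥ 4 (so that n−k ≥ 2 is possible), and let {·,…,·} be a Nambu-Poisson bracket of order n on C^∞(M;ℝ). Fix k with 1 ≤ k ≤ n−2 and fixed functions F_1,…,F_k ∈ C^∞(M;ℝ). Then the (n−k)-ary bracket {f_1,…,f_{n−k}}' := {F_1,…,F_k, f_1,…,f_{n−k}} is again a Nambu-Poisson bracket of order n−k on C^∞(M;ℝ): it is alternating, ℝ-multilinear, satisfies the Leibniz rule, and satisfies the Fundamental identity (the subordinate Nambu structure). -/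
open scoped Manifold
local notation "∞" => (⊤ : ℕ∞)

/-- The Fundamental identity for an `(p+1)`-ary bracket. -/
def FundamentalIdentity {V : Type*} [AddCommMonoid V] {p : ℕ}
    (B : (Fin (p + 1) → V) → V) : Prop :=
  ∀ (f : Fin p → V) (g : Fin (p + 1) → V),
    B (Fin.snoc f (B g)) = ∑ k, B (Function.update g k (B (Fin.snoc f (g k))))

/-- The Leibniz rule in each argument for an `n`-ary bracket on a commutative ring. -/
def LeibnizRule {A : Type*} [CommRing A] {n : ℕ} (B : (Fin n → A) → A) : Prop :=
  ∀ (v : Fin n → A) (i : Fin n) (f g : A),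
    B (Function.update v i (f * g)) =
      f * B (Function.update v i g) + B (Function.update v i f) * g

namespace Fin

variable {α : Type*} {k m : ℕ}

theorem append_update_right [DecidableEq (Fin m)] (F : Fin k → α) (f : Fin m → α) (i : Fin m)
    (x : α) :
    append F (Function.update f i x) = Function.update (append F f) (natAdd k i) x := by
  ext j
  induction j using Fin.addCases with
  | left j =>
    rw [append_left, Function.update_of_ne, append_left]
    exact Fin.ne_of_val_ne (by simp; omega)
  | right j =>
    rw [append_right]
    by_cases h : j = i
    · subst h; simp
    · rw [Function.update_of_ne h, Function.update_of_ne, append_right]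
      simpa using h

end Fin

namespace AlternatingMap

variable {R V W : Type*} [CommSemiring R] [AddCommMonoid V] [Module R V]
  [AddCommMonoid W] [Module R W] {k m : ℕ}

/-- The alternating map obtained by fixing the first `k` arguments of an alternating map. -/
def fixFirst (B : AlternatingMap R V W (Fin (k + m))) (F : Fin k → V) :
    AlternatingMap R V W (Fin m) where
  toFun f := B (Fin.append F f)
  map_update_add' f i x y := by
    simp only [Fin.append_update_right, B.map_update_add]
  map_update_smul' f i c x := by
    simp only [Fin.append_update_right, B.map_update_smul]
  map_eq_zero_of_eq' f i j hij hne :=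
    B.map_eq_zero_of_eq _ (i := Fin.natAdd k i) (j := Fin.natAdd k j) (by simpa using hij)
      (by simpa using hne)

theorem fixFirst_apply (B : AlternatingMap R V W (Fin (k + m))) (F : Fin k → V)
    (f : Fin m → V) : B.fixFirst F f = B (Fin.append F f) := rfl

end AlternatingMap

theorem LeibnizRule.fixFirst {R A : Type*} [CommRing R] [CommRing A] [Algebra R A] {k m : ℕ}
    {B : AlternatingMap R A A (Fin (k + m))} (hB : LeibnizRule ⇑B) (F : Fin k → A) :
    LeibnizRule ⇑(B.fixFirst F) := by
  intro v i f g
  simp only [AlternatingMap.fixFirst_apply, Fin.append_update_right]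
  exact hB _ _ f g

/-- The terms of the Fundamental identity that act on a fixed argument `F i` vanish, because
`F i` then occurs twice in the inner bracket. -/
theorem FundamentalIdentity.fixFirst {R V : Type*} [CommRing R] [AddCommGroup V] [Module R V]
    {k p : ℕ} {B : AlternatingMap R V V (Fin (k + (p + 1)))}
    (hB : FundamentalIdentity (p := k + p) ⇑B) (F : Fin k → V) :
    FundamentalIdentity ⇑(B.fixFirst F) := by
  intro f g
  simp only [AlternatingMap.fixFirst_apply, Fin.append_snoc, Fin.append_update_right]
  refine (hB (Fin.append F f) (Fin.append (n := p + 1) F g)).trans ?_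
  refine (Fin.sum_univ_add (a := k) (b := p + 1) _).trans ?_
  rw [Finset.sum_eq_zero, zero_add]
  · simp only [Fin.append_right]
  · intro i _
    have h : B (Fin.snoc (Fin.append F f) (F i) : Fin (k + p + 1) → V) = 0 := by
      rw [← Fin.append_snoc]
      exact B.map_eq_zero_of_eq _ (i := Fin.castAdd (p + 1) i) (j := Fin.natAdd k (Fin.last p))
        (by rw [Fin.append_left, Fin.append_right, Fin.snoc_last]) (Fin.ne_of_val_ne (by simp; omega))
    rw [Fin.append_left, h]
    exact B.map_update_zero _ _

/-- let `{·,…,·}` be a Nambu-Poisson bracket of order `n = k + (q+2) ≥ 4` on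
`C^∞(M;ℝ)` (alternating, `ℝ`-multilinear, Leibniz, Fundamental identity), `1 ≤ k ≤ n-2`, and
fix `F₁,…,F_k ∈ C^∞(M;ℝ)`.  Then the `(n-k)`-ary bracket
`{f₁,…,f_{n-k}}' := {F₁,…,F_k, f₁,…,f_{n-k}}` is again a Nambu-Poisson bracket of order
`n - k = q + 2` on `C^∞(M;ℝ)`: alternating, `ℝ`-multilinear, Leibniz, and satisfying the
Fundamental identity (the subordinate Nambu structure). -/
theorem subordinate_nambu_structure
    {E : Type*} [NormedAddCommGroup E] [NormedSpace ℝ E] [FiniteDimensional ℝ E]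
    {H : Type*} [TopologicalSpace H] (I : ModelWithCorners ℝ E H) [I.Boundaryless]
    {M : Type*} [TopologicalSpace M] [ChartedSpace H M] [IsManifold I ∞ M]
    {k q : ℕ} (hk : 1 ≤ k) (hn : 4 ≤ k + (q + 2))
    (B : AlternatingMap ℝ C^∞⟮I, M; ℝ⟯ C^∞⟮I, M; ℝ⟯ (Fin (k + (q + 2))))
    (hLeib : LeibnizRule ⇑B) (hFI : FundamentalIdentity ⇑B)
    (F : Fin k → C^∞⟮I, M; ℝ⟯) :
    ∃ B' : AlternatingMap ℝ C^∞⟮I, M; ℝ⟯ C^∞⟮I, M; ℝ⟯ (Fin (q + 2)),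
      (∀ f : Fin (q + 2) → C^∞⟮I, M; ℝ⟯, B' f = B (Fin.append F f)) ∧
      LeibnizRule ⇑B' ∧ FundamentalIdentity ⇑B' := by
  exact ⟨B.fixFirst F, fun _ => rfl, hLeib.fixFirst F, hFI.fixFirst F⟩
end

section
/- Let M be a smooth finite-dimensional manifold without boundary equipped with a Nambu-Poisson bracket {·}_M of order n (n ≥ 2), let N be a smooth finite-dimensional manifold without boundary, and let φ : M → N be a surjective submersion. Then there exists a Nambu-Poisson bracket {·}_N of order n on C^∞(N;ℝ) making φ a Nambu-Poisson map (i.e. {f_1∘φ,…,f_n∘φ}_M = {f_1,…,f_n}_N ∘ φ for all f_i ∈ C^∞(N;ℝ)) if and only if for all f_1,…,f_n ∈ C^∞(N;ℝ) the function {f_1∘φ,…,f_n∘φ}_M is constant along the fibers of φ (i.e. it takes equal values at any x, y ∈ M with φ(x) = φ(y)). Moreover, such a coinduced bracket is unique. -/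
open scoped Manifold
local notation "∞" => (⊤ : ℕ∞)

open scoped Topology

/-- The algebra homomorphism `C^∞(N;ℝ) → C^∞(M;ℝ)`, `f ↦ f ∘ φ`. -/
noncomputable def ContMDiffMap.pullbackAlgHom
    {E : Type*} [NormedAddCommGroup E] [NormedSpace ℝ E]
    {H : Type*} [TopologicalSpace H] {I : ModelWithCorners ℝ E H}
    {M : Type*} [TopologicalSpace M] [ChartedSpace H M]
    {E' : Type*} [NormedAddCommGroup E'] [NormedSpace ℝ E']
    {H' : Type*} [TopologicalSpace H'] {J : ModelWithCorners ℝ E' H'}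
    {N : Type*} [TopologicalSpace N] [ChartedSpace H' N]
    (φ : C^∞⟮I, M; J, N⟯) : C^∞⟮J, N; ℝ⟯ →ₐ[ℝ] C^∞⟮I, M; ℝ⟯ where
  toFun f := f.comp φ
  map_one' := rfl
  map_mul' _ _ := rfl
  map_zero' := rfl
  map_add' _ _ := rfl
  commutes' _ := rfl

/-- An alternating bracket with the Leibniz rule and the Fundamental identity descends along an
injective algebra homomorphism whose range is closed under the bracket. -/
theorem exists_nambuBracket_of_injective {R A B : Type*} [CommRing R] [CommRing A] [CommRing B]
    [Algebra R A] [Algebra R B] {p : ℕ} (c : A →ₐ[R] B) (hc : Function.Injective c)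
    (β : AlternatingMap R B B (Fin (p + 1))) (hL : LeibnizRule ⇑β) (hF : FundamentalIdentity ⇑β)
    (hrange : ∀ f : Fin (p + 1) → A, ∃ a, c a = β (c ∘ f)) :
    ∃ α : AlternatingMap R A A (Fin (p + 1)),
      LeibnizRule ⇑α ∧ FundamentalIdentity ⇑α ∧ ∀ f, c (α f) = β (c ∘ f) := by
  choose a ha using hrange
  refine ⟨⟨⟨a, ?_, ?_⟩, ?_⟩, ?_, ?_, ha⟩
  · intro _ m i x y
    apply hc
    simp only [map_add, ha, Function.comp_update, β.map_update_add]
  · intro _ m i r x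
    apply hc
    simp only [map_smul, ha, Function.comp_update, β.map_update_smul]
  · intro v i j hij hne
    apply hc
    change c (a v) = c 0
    rw [ha, map_zero]
    exact β.map_eq_zero_of_eq _ (congrArg c hij) hne
  · intro v i f g
    apply hc
    change c (a _) = c (f * a _ + a _ * g)
    simp only [map_add, map_mul, ha, Function.comp_update]
    exact hL _ _ _ _
  · intro f g
    apply hc
    change c (a (Fin.snoc f (a g))) = c (∑ k, a (Function.update g k (a (Fin.snoc f (g k)))))
    have hsnoc (x : A) : c ∘ (Fin.snoc f x : Fin (p + 1) → A) = Fin.snoc (c ∘ f) (c x) :=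
      Fin.comp_snoc c f x
    simp only [map_sum, ha, Function.comp_update, hsnoc]
    exact hF _ _

/-- A smooth map with surjective derivative at `a` has a smooth local right inverse through `a`. -/
theorem ContDiffAt.exists_local_rightInverse
    {E : Type*} [NormedAddCommGroup E] [NormedSpace ℝ E]
    {F : Type*} [NormedAddCommGroup F] [NormedSpace ℝ F] [FiniteDimensional ℝ F]
    {f : E → F} {a : E} {n : WithTop ℕ∞} (hf : ContDiffAt ℝ n f a) (hn : n ≠ 0)
    (hsurj : Function.Surjective (fderiv ℝ f a)) :
    ∃ s : F → E, ContDiffAt ℝ n s (f a) ∧ s (f a) = a ∧ ∀ᶠ y in 𝓝 (f a), f (s y) = y := by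
  have : CompleteSpace F := FiniteDimensional.complete ℝ F
  obtain ⟨L, hL'⟩ := (fderiv ℝ f a).exists_rightInverse_of_surjective
    (LinearMap.range_eq_top.2 hsurj)
  have hL (v : F) : fderiv ℝ f a (L v) = v := DFunLike.congr_fun hL' v
  let ψ : F → F := fun v => f (a + L v)
  have hψ0 : ψ 0 = f a := by simp [ψ]
  have hf0 : ContDiffAt ℝ n f (a + L 0) := by simpa using hf
  have hψ : ContDiffAt ℝ n ψ 0 :=
    hf0.comp (0 : F) (contDiffAt_const.add L.contDiff.contDiffAt)
  have hψ' : HasFDerivAt ψ ((ContinuousLinearEquiv.refl ℝ F : F ≃L[ℝ] F) : F →L[ℝ] F) 0 := by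
    have h1 : HasFDerivAt f (fderiv ℝ f a) (a + L 0) := by
      simpa using (hf.differentiableAt hn).hasFDerivAt
    have h2 := h1.comp (0 : F) (L.hasFDerivAt.const_add a)
    exact h2.congr_fderiv (ContinuousLinearMap.ext hL)
  have hstrict := hψ.hasStrictFDerivAt' hψ' hn
  refine ⟨fun y => a + L (hψ.localInverse hψ' hn y), ?_, ?_, ?_⟩
  · have := hψ.to_localInverse hψ' hn
    rw [hψ0] at this
    exact contDiffAt_const.add (L.contDiff.contDiffAt.comp _ this)
  · have := hψ.localInverse_apply_image hψ' hn
    rw [hψ0] at this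
    simp [this]
  · have := hstrict.eventually_right_inverse
    rw [hψ0] at this
    exact this

/-- A smooth map with surjective derivative at `x` has a smooth local section through `x`. -/
theorem ContMDiffAt.exists_local_section
    {E : Type*} [NormedAddCommGroup E] [NormedSpace ℝ E]
    {H : Type*} [TopologicalSpace H] {I : ModelWithCorners ℝ E H} [I.Boundaryless]
    {M : Type*} [TopologicalSpace M] [ChartedSpace H M]
    {E' : Type*} [NormedAddCommGroup E'] [NormedSpace ℝ E'] [FiniteDimensional ℝ E']
    {H' : Type*} [TopologicalSpace H'] {J : ModelWithCorners ℝ E' H'} [J.Boundaryless]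
    {N : Type*} [TopologicalSpace N] [ChartedSpace H' N]
    {n : WithTop ℕ∞} [IsManifold I n M] [IsManifold J n N]
    {φ : M → N} {x : M} (hφ : ContMDiffAt I J n φ x) (hn : n ≠ 0)
    (hsurj : Function.Surjective (mfderiv I J φ x)) :
    ∃ s : N → M, ContMDiffAt J I n s (φ x) ∧ s (φ x) = x ∧ ∀ᶠ y in 𝓝 (φ x), φ (s y) = y := by
  have hF : ContDiffAt ℝ n (writtenInExtChartAt I J x φ) (extChartAt I x x) := by
    have := (contMDiffAt_iff.1 hφ).2
    rwa [I.range_eq_univ, contDiffWithinAt_univ] at this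
  have hder : Function.Surjective
      (fderiv ℝ (writtenInExtChartAt I J x φ) (extChartAt I x x)) := by
    rw [(hφ.mdifferentiableAt hn).mfderiv, I.range_eq_univ, fderivWithin_univ] at hsurj
    exact hsurj
  obtain ⟨σ, hσ, hσa, hσr⟩ := hF.exists_local_rightInverse hn hder
  have hval : writtenInExtChartAt I J x φ (extChartAt I x x) = extChartAt J (φ x) (φ x) := by
    simp [writtenInExtChartAt]
  rw [hval] at hσ hσa hσr
  set e := extChartAt I x
  set e' := extChartAt J (φ x)
  have hs : ContMDiffAt J I n (fun y => e.symm (σ (e' y))) (φ x) := by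
    have h1 : ContMDiffAt J 𝓘(ℝ, E') n e' (φ x) := contMDiffAt_extChartAt
    have h2 : ContMDiffAt J 𝓘(ℝ, E) n (fun y => σ (e' y)) (φ x) :=
      hσ.contMDiffAt.comp (φ x) h1
    have h3 : ContMDiffAt 𝓘(ℝ, E) I n e.symm (σ (e' (φ x))) := by
      rw [hσa]
      exact (contMDiffOn_extChartAt_symm x).contMDiffAt (extChartAt_target_mem_nhds x)
    exact h3.comp (φ x) h2
  have hsx : e.symm (σ (e' (φ x))) = x := by
    rw [hσa]
    exact extChartAt_to_inv x
  refine ⟨fun y => e.symm (σ (e' y)), hs, hsx, ?_⟩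
  have hcont : Filter.Tendsto (fun y => φ (e.symm (σ (e' y)))) (𝓝 (φ x)) (𝓝 (φ x)) := by
    have h := hφ.continuousAt.tendsto
    have h' := hs.continuousAt.tendsto
    rw [hsx] at h'
    exact h.comp h'
  filter_upwards [(continuousAt_extChartAt (φ x)).eventually hσr,
    hcont (extChartAt_source_mem_nhds (I := J) (φ x)),
    extChartAt_source_mem_nhds (I := J) (φ x)] with y hy hy1 hy2
  exact e'.injOn hy1 hy2 hy

/-- A function on the target of a surjective submersion is smooth as soon as its pullback is. -/
theorem ContMDiff.of_comp_submersion
    {E : Type*} [NormedAddCommGroup E] [NormedSpace ℝ E]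
    {H : Type*} [TopologicalSpace H] {I : ModelWithCorners ℝ E H} [I.Boundaryless]
    {M : Type*} [TopologicalSpace M] [ChartedSpace H M]
    {E' : Type*} [NormedAddCommGroup E'] [NormedSpace ℝ E'] [FiniteDimensional ℝ E']
    {H' : Type*} [TopologicalSpace H'] {J : ModelWithCorners ℝ E' H'} [J.Boundaryless]
    {N : Type*} [TopologicalSpace N] [ChartedSpace H' N]
    {E'' : Type*} [NormedAddCommGroup E''] [NormedSpace ℝ E'']
    {H'' : Type*} [TopologicalSpace H''] {K : ModelWithCorners ℝ E'' H''}
    {P : Type*} [TopologicalSpace P] [ChartedSpace H'' P]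
    {n : WithTop ℕ∞} [IsManifold I n M] [IsManifold J n N]
    {φ : M → N} (hφ : ContMDiff I J n φ) (hn : n ≠ 0) (hsurj : Function.Surjective φ)
    (hsubm : ∀ x, Function.Surjective (mfderiv I J φ x)) {h : N → P}
    (hh : ContMDiff I K n (h ∘ φ)) : ContMDiff J K n h := by
  intro y
  obtain ⟨x, rfl⟩ := hsurj y
  obtain ⟨s, hs, -, hφs⟩ := (hφ x).exists_local_section hn (hsubm x)
  refine (hh.contMDiffAt.comp (φ x) hs).congr_of_eventuallyEq ?_
  filter_upwards [hφs] with z hz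
  simp [hz]

/-- let `(M, {·}_M)` be a Nambu-Poisson manifold of order `n = q+2 ≥ 2` and
`φ : M → N` a surjective submersion.  Then there is a Nambu-Poisson bracket of order `n` on
`C^∞(N;ℝ)` making `φ` a Nambu-Poisson map iff, for all `f₁,…,fₙ ∈ C^∞(N;ℝ)`, the function
`{f₁∘φ,…,fₙ∘φ}_M` is constant along the fibers of `φ`; moreover such a coinduced bracket is
unique. -/
theorem coinduced_nambu_structure_iff_fiber_constant
    {E : Type*} [NormedAddCommGroup E] [NormedSpace ℝ E] [FiniteDimensional ℝ E]
    {H : Type*} [TopologicalSpace H] {I : ModelWithCorners ℝ E H} [I.Boundaryless]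
    {M : Type*} [TopologicalSpace M] [ChartedSpace H M] [IsManifold I ∞ M]
    {E' : Type*} [NormedAddCommGroup E'] [NormedSpace ℝ E'] [FiniteDimensional ℝ E']
    {H' : Type*} [TopologicalSpace H'] {J : ModelWithCorners ℝ E' H'} [J.Boundaryless]
    {N : Type*} [TopologicalSpace N] [ChartedSpace H' N] [IsManifold J ∞ N]
    {q : ℕ}
    (BM : AlternatingMap ℝ C^∞⟮I, M; ℝ⟯ C^∞⟮I, M; ℝ⟯ (Fin (q + 2)))
    (hLeibM : LeibnizRule ⇑BM) (hFIM : FundamentalIdentity ⇑BM)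
    (φ : C^∞⟮I, M; J, N⟯) (hsurj : Function.Surjective φ)
    (hsubm : ∀ x : M, Function.Surjective (mfderiv I J φ x)) :
    ((∃ BN : AlternatingMap ℝ C^∞⟮J, N; ℝ⟯ C^∞⟮J, N; ℝ⟯ (Fin (q + 2)),
        LeibnizRule ⇑BN ∧ FundamentalIdentity ⇑BN ∧
        ∀ f : Fin (q + 2) → C^∞⟮J, N; ℝ⟯, ∀ x : M,
          BM (fun i => (f i).comp φ) x = BN f (φ x)) ↔
      (∀ f : Fin (q + 2) → C^∞⟮J, N; ℝ⟯, ∀ x y : M, φ x = φ y →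
        BM (fun i => (f i).comp φ) x = BM (fun i => (f i).comp φ) y)) ∧
    (∀ BN₁ BN₂ : AlternatingMap ℝ C^∞⟮J, N; ℝ⟯ C^∞⟮J, N; ℝ⟯ (Fin (q + 2)),
      (LeibnizRule ⇑BN₁ ∧ FundamentalIdentity ⇑BN₁ ∧
        ∀ f : Fin (q + 2) → C^∞⟮J, N; ℝ⟯, ∀ x : M,
          BM (fun i => (f i).comp φ) x = BN₁ f (φ x)) →
      (LeibnizRule ⇑BN₂ ∧ FundamentalIdentity ⇑BN₂ ∧
        ∀ f : Fin (q + 2) → C^∞⟮J, N; ℝ⟯, ∀ x : M,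
          BM (fun i => (f i).comp φ) x = BN₂ f (φ x)) →
      BN₁ = BN₂) := by
  let c := ContMDiffMap.pullbackAlgHom φ
  have hc : Function.Injective c := fun f g hfg => by
    ext y
    obtain ⟨x, rfl⟩ := hsurj y
    exact congrArg (fun k : C^∞⟮I, M; ℝ⟯ => k x) hfg
  refine ⟨⟨?_, fun hconst => ?_⟩, ?_⟩
  · rintro ⟨BN, -, -, hBN⟩ f x y hxy
    rw [hBN, hBN, hxy]
  · have hrange (f : Fin (q + 2) → C^∞⟮J, N; ℝ⟯) : ∃ a, c a = BM (c ∘ f) := by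
      let h : N → ℝ := fun y => BM (c ∘ f) (Function.surjInv hsurj y)
      have hcomp : h ∘ φ = BM (c ∘ f) :=
        funext fun x => hconst f _ _ (Function.surjInv_eq hsurj (φ x))
      have hh : ContMDiff J 𝓘(ℝ, ℝ) ∞ h :=
        ContMDiff.of_comp_submersion φ.contMDiff (by simp) hsurj hsubm
          (hcomp ▸ (BM (c ∘ f)).contMDiff)
      exact ⟨⟨h, hh⟩, ContMDiffMap.ext (congrFun hcomp)⟩
    obtain ⟨BN, hL, hF, hBN⟩ := exists_nambuBracket_of_injective c hc BM hLeibM hFIM hrange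
    exact ⟨BN, hL, hF, fun f x => congrArg (fun k : C^∞⟮I, M; ℝ⟯ => k x) (hBN f).symm⟩
  · rintro BN₁ BN₂ ⟨-, -, h₁⟩ ⟨-, -, h₂⟩
    ext f y
    obtain ⟨x, rfl⟩ := hsurj y
    rw [← h₁, ← h₂]
end

section
/- Let M be a smooth finite-dimensional manifold without boundary equipped with a Nambu-Poisson bracket {·}_M of order n (n ≥ 2), let N be a smooth finite-dimensional manifold without boundary, and let φ : M → N be a surjective submersion whose fibers φ^{-1}({y}) are connected. Assume that for every m ∈ M the kernel of mfderiv φ m is contained in the ℝ-linear span of the Hamiltonian tangent vectors at m that are tangent to the fibers of φ, i.e. of the set of v ∈ T_m M for which there exist g_1,…,g_{n-1} ∈ C^∞(M;ℝ) with {g_1,…,g_{n-1}, f∘φ}_M = 0 for all f ∈ C^∞(N;ℝ) and with (mfderiv h m)(v) = {g_1,…,g_{n-1}, h}_M(m) for all h ∈ C^∞(M;ℝ). Then there exists a (unique) Nambu-Poisson bracket of order n on C^∞(N;ℝ) coinduced by φ, i.e. such that {f_1∘φ,…,f_n∘φ}_M = {f_1,…,f_n}_N ∘ φ for all f_1,…,f_n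 ∈ C^∞(N;ℝ). -/
open scoped Manifold
local notation "∞" => (⊤ : ℕ∞)

open Filter Topology

theorem ContDiffAt.eventually_differentiableAt {E F : Type*}
    [NormedAddCommGroup E] [NormedSpace ℝ E] [NormedAddCommGroup F] [NormedSpace ℝ F]
    {n : WithTop ℕ∞} (hn : 1 ≤ n) {f : E → F} {x : E} (hf : ContDiffAt ℝ n f x) :
    ∀ᶠ y in 𝓝 x, DifferentiableAt ℝ f y :=
  ((hf.of_le hn).eventually (by simp)).mono fun _ hy => hy.differentiableAt one_ne_zero

/-- A `C^n` function whose derivative vanishes on the kernel of the derivative of a `C^n` submersion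
factors locally through the submersion, with a `C^n` factor. -/
theorem ContDiffAt.exists_factor_of_fderiv_ker
    {E F G : Type*} [NormedAddCommGroup E] [NormedSpace ℝ E] [FiniteDimensional ℝ E]
    [NormedAddCommGroup F] [NormedSpace ℝ F] [FiniteDimensional ℝ F]
    [NormedAddCommGroup G] [NormedSpace ℝ G] {n : WithTop ℕ∞} (hn : 1 ≤ n)
    {f : E → F} {h : E → G} {a : E} (hf : ContDiffAt ℝ n f a) (hh : ContDiffAt ℝ n h a)
    (hsurj : Function.Surjective (fderiv ℝ f a))
    (hker : ∀ᶠ x in 𝓝 a, ∀ v, fderiv ℝ f x v = 0 → fderiv ℝ h x v = 0) :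
    ∃ g : F → G, ContDiffAt ℝ n g (f a) ∧ h =ᶠ[𝓝 a] g ∘ f := by
  have hn0 : n ≠ 0 := (lt_of_lt_of_le zero_lt_one hn).ne'
  set f' := fderiv ℝ f a
  have hrange : f'.range = ⊤ := LinearMap.range_eq_top.2 hsurj
  obtain ⟨P, hP⟩ := f'.ker_closedComplemented_of_finiteDimensional_range
  set L : E ≃L[ℝ] F × f'.ker := f'.equivProdOfSurjectiveOfIsCompl P hrange
    (LinearMap.range_eq_of_proj hP) (LinearMap.isCompl_of_proj hP)
  set Φ : E → F × f'.ker := fun x => (f x, P x) with hΦ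
  have hΦd : ContDiffAt ℝ n Φ a := hf.prodMk P.contDiff.contDiffAt
  have hΦL : HasFDerivAt Φ (L : E →L[ℝ] F × f'.ker) a :=
    (hf.differentiableAt hn0).hasFDerivAt.prodMk P.hasFDerivAt
  set e := hΦd.toOpenPartialHomeomorph Φ hΦL hn0
  have hes : a ∈ e.source := hΦd.mem_toOpenPartialHomeomorph_source hΦL hn0
  have het : Φ a ∈ e.target := hΦd.image_mem_toOpenPartialHomeomorph_target hΦL hn0
  have hea : e.symm (Φ a) = a := e.left_inv hes
  have hsymm : ContDiffAt ℝ n e.symm (Φ a) := hΦd.to_localInverse hΦL hn0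
  have htend : Tendsto e.symm (𝓝 (Φ a)) (𝓝 a) := by
    simpa only [hea] using hsymm.continuousAt.tendsto
  have hright : ∀ p ∈ e.target, f (e.symm p) = p.1 := fun p hp =>
    congrArg Prod.fst (e.right_inv hp)
  have hH : ContDiffAt ℝ n (h ∘ e.symm) (Φ a) := ContDiffAt.comp _ (by rwa [hea]) hsymm
  have hev : ∀ᶠ p in 𝓝 (Φ a), DifferentiableAt ℝ (h ∘ e.symm) p ∧
      ∀ k, fderiv ℝ (h ∘ e.symm) p (0, k) = 0 := by
    filter_upwards [htend.eventually (hf.eventually_differentiableAt hn),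
      htend.eventually (hh.eventually_differentiableAt hn), hsymm.eventually_differentiableAt hn,
      htend.eventually hker, e.open_target.mem_nhds het] with p hfp hhp hsp hkp hp
    refine ⟨hhp.comp p hsp, fun k => ?_⟩
    rw [fderiv_comp p hhp hsp]
    refine hkp _ ?_
    have hfst : f ∘ e.symm =ᶠ[𝓝 p] Prod.fst :=
      eventually_of_mem (e.open_target.mem_nhds hp) hright
    have := congrArg (fun T => T (0, k)) (hfst.fderiv_eq (𝕜 := ℝ))
    rw [fderiv_comp p hfp hsp] at this
    simpa [fderiv_fst] using this
  obtain ⟨r, hr, hball⟩ := Metric.eventually_nhds_iff_ball.1 hev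
  refine ⟨fun y => h (e.symm (y, P a)), ?_, ?_⟩
  · exact ContDiffAt.comp (g := h ∘ e.symm) (f := fun y => (y, P a)) (f a) hH
      (contDiffAt_id.prodMk contDiffAt_const)
  · filter_upwards [hΦd.continuousAt (Metric.ball_mem_nhds _ hr), e.open_source.mem_nhds hes]
      with x hx hxs
    have hx' : (f x, P x) ∈ Metric.ball (f a) r ×ˢ Metric.ball (P a) r := by
      rw [ball_prod_same]; exact hx
    have hsub : ∀ k ∈ Metric.ball (P a) r, (f x, k) ∈ Metric.ball (Φ a) r := fun k hk => by
      rw [hΦ, ← ball_prod_same]; exact ⟨hx'.1, hk⟩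
    have hder : ∀ k ∈ Metric.ball (P a) r,
        HasFDerivAt (fun k => h (e.symm (f x, k))) (0 : f'.ker →L[ℝ] G) k := fun k hk => by
      obtain ⟨hd, h0⟩ := hball _ (hsub k hk)
      have := hd.hasFDerivAt.comp k (hasFDerivAt_prodMk_right (𝕜 := ℝ) (f x) k)
      exact this.congr_fderiv (ContinuousLinearMap.ext fun v => h0 v)
    have := Metric.isOpen_ball.is_const_of_fderiv_eq_zero (𝕜 := ℝ)
      (convex_ball (P a) r).isPreconnected
      (fun k hk => (hder k hk).differentiableAt.differentiableWithinAt)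
      (fun k hk => (hder k hk).fderiv) hx'.2 (Metric.mem_ball_self hr)
    rw [Function.comp_apply, ← this]
    exact congrArg h (e.left_inv hxs).symm

section Submersion

variable {E : Type*} [NormedAddCommGroup E] [NormedSpace ℝ E]
  {H : Type*} [TopologicalSpace H] {I : ModelWithCorners ℝ E H} [I.Boundaryless]
  {M : Type*} [TopologicalSpace M] [ChartedSpace H M]
  {E' : Type*} [NormedAddCommGroup E'] [NormedSpace ℝ E']
  {H' : Type*} [TopologicalSpace H'] {J : ModelWithCorners ℝ E' H'}
  {N : Type*} [TopologicalSpace N] [ChartedSpace H' N]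
  {G : Type*} [NormedAddCommGroup G] [NormedSpace ℝ G]
  {n : WithTop ℕ∞}

theorem contMDiffAt_extChartAt_symm_of_mem_target [IsManifold I n M] (m : M) {x : E}
    (hx : x ∈ (extChartAt I m).target) :
    ContMDiffAt 𝓘(ℝ, E) I n (extChartAt I m).symm x :=
  (contMDiffOn_extChartAt_symm m).contMDiffAt ((isOpen_extChartAt_target m).mem_nhds hx)

theorem surjective_mfderiv_extChartAt_symm [IsManifold I 1 M] (m : M) {x : E}
    (hx : x ∈ (extChartAt I m).target) :
    Function.Surjective (mfderiv 𝓘(ℝ, E) I (extChartAt I m).symm x) := by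
  have := isInvertible_mfderivWithin_extChartAt_symm (I := I) hx
  rw [I.range_eq_univ, mfderivWithin_univ] at this
  exact this.surjective

/-- The derivative of a map in charts is the manifold derivative conjugated by those of the
charts. -/
theorem fderiv_extChartAt_comp [IsManifold I 1 M] [IsManifold J 1 N] {φ : M → N} (m : M) {x : E}
    (hx : x ∈ (extChartAt I m).target)
    (hφ : MDifferentiableAt I J φ ((extChartAt I m).symm x))
    (hy : φ ((extChartAt I m).symm x) ∈ (chartAt H' (φ m)).source) (v : E) :
    fderiv ℝ (extChartAt J (φ m) ∘ φ ∘ (extChartAt I m).symm) x v =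
      mfderiv J 𝓘(ℝ, E') (extChartAt J (φ m)) (φ ((extChartAt I m).symm x))
        (mfderiv I J φ ((extChartAt I m).symm x)
          (mfderiv 𝓘(ℝ, E) I (extChartAt I m).symm x v)) := by
  have hc : MDifferentiableAt 𝓘(ℝ, E) I (extChartAt I m).symm x :=
    (contMDiffAt_extChartAt_symm_of_mem_target (n := 1) m hx).mdifferentiableAt one_ne_zero
  rw [← mfderiv_eq_fderiv, mfderiv_comp x (g := extChartAt J (φ m))
    (mdifferentiableAt_extChartAt hy) (hφ.comp x hc), mfderiv_comp x hφ hc]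
  rfl

theorem eventually_mem_target_and_mem_source {φ : M → N} {m : M} (hφ : ContinuousAt φ m) :
    ∀ᶠ x in 𝓝 (extChartAt I m m), x ∈ (extChartAt I m).target ∧
      φ ((extChartAt I m).symm x) ∈ (chartAt H' (φ m)).source := by
  have hφ' : Tendsto (φ ∘ (extChartAt I m).symm) (𝓝 (extChartAt I m m)) (𝓝 (φ m)) :=
    hφ.tendsto.comp (by simpa using (continuousAt_extChartAt_symm (I := I) m).tendsto)
  exact Filter.Eventually.and (extChartAt_target_mem_nhds m)
    (hφ' ((chartAt H' (φ m)).open_source.mem_nhds (mem_chart_source H' (φ m))))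

theorem contDiffAt_extChartAt_comp [IsManifold I n M] [IsManifold J n N] {φ : M → N} {m : M}
    (hφ : ContMDiffAt I J n φ m) :
    ContDiffAt ℝ n (extChartAt J (φ m) ∘ φ ∘ (extChartAt I m).symm) (extChartAt I m m) := by
  have hc := contMDiffAt_extChartAt_symm_of_mem_target (n := n) m (mem_extChartAt_target (I := I) m)
  have hm : (extChartAt I m).symm (extChartAt I m m) = m := extChartAt_to_inv m
  refine ContMDiffAt.contDiffAt (ContMDiffAt.comp (I' := J) _ ?_ (ContMDiffAt.comp (I' := I) _ ?_ hc))
  · simpa only [Function.comp_apply, hm] using contMDiffAt_extChartAt (I := J) (x := φ m)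
  · rwa [hm]

theorem surjective_fderiv_extChartAt_comp [IsManifold I 1 M] [IsManifold J 1 N]
    {φ : M → N} {m : M} (hφ : MDifferentiableAt I J φ m)
    (hsurj : Function.Surjective (mfderiv I J φ m)) :
    Function.Surjective
      (fderiv ℝ (extChartAt J (φ m) ∘ φ ∘ (extChartAt I m).symm) (extChartAt I m m)) := by
  have hm : (extChartAt I m).symm (extChartAt I m m) = m := extChartAt_to_inv m
  have hmt := mem_extChartAt_target (I := I) m
  have hd : Function.Surjective
      (mfderiv J 𝓘(ℝ, E') (extChartAt J (φ m)) (φ ((extChartAt I m).symm (extChartAt I m m)))) := by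
    rw [hm]; exact (isInvertible_mfderiv_extChartAt (mem_extChartAt_source (φ m))).surjective
  have hs : Function.Surjective (mfderiv I J φ ((extChartAt I m).symm (extChartAt I m m))) := by
    rwa [hm]
  intro w
  obtain ⟨u, rfl⟩ := hd w
  obtain ⟨u, rfl⟩ := hs u
  obtain ⟨v, rfl⟩ := surjective_mfderiv_extChartAt_symm m hmt u
  exact ⟨v, fderiv_extChartAt_comp m hmt (by rwa [hm]) (by rw [hm]; exact mem_chart_source H' _) v⟩

variable [FiniteDimensional ℝ E] [FiniteDimensional ℝ E']

/-- A submersion maps neighbourhoods to neighbourhoods. -/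
theorem ContMDiffAt.nhds_le_map_of_surjective_mfderiv [J.Boundaryless]
    [IsManifold I 1 M] [IsManifold J 1 N] {φ : M → N} {m : M} (hφ : ContMDiffAt I J 1 φ m)
    (hsurj : Function.Surjective (mfderiv I J φ m)) : 𝓝 (φ m) ≤ map φ (𝓝 m) := by
  have hm : (extChartAt I m).symm (extChartAt I m m) = m := extChartAt_to_inv m
  have hmap := ((contDiffAt_extChartAt_comp hφ).hasStrictFDerivAt one_ne_zero).map_nhds_eq_of_surj
    (LinearMap.range_eq_top.2
      (surjective_fderiv_extChartAt_comp (hφ.mdifferentiableAt one_ne_zero) hsurj))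
  have hd : Tendsto (extChartAt J (φ m)).symm (𝓝 (extChartAt J (φ m) (φ m))) (𝓝 (φ m)) := by
    simpa using (continuousAt_extChartAt_symm (I := J) (φ m)).tendsto
  have hc : Tendsto (extChartAt I m).symm (𝓝 (extChartAt I m m)) (𝓝 m) := by
    simpa using (continuousAt_extChartAt_symm (I := I) m).tendsto
  intro s hs
  have hs' : ∀ᶠ x in 𝓝 (extChartAt I m m), φ ((extChartAt I m).symm x) ∈ s := hc hs
  have key : ∀ᶠ y in 𝓝 (extChartAt J (φ m) (φ m)), (extChartAt J (φ m)).symm y ∈ s := by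
    have : ∀ᶠ y in map (extChartAt J (φ m) ∘ φ ∘ (extChartAt I m).symm) (𝓝 (extChartAt I m m)),
        (extChartAt J (φ m)).symm y ∈ s := by
      rw [eventually_map]
      filter_upwards [hs', eventually_mem_target_and_mem_source (H' := H') hφ.continuousAt]
        with x hx hx'
      rwa [Function.comp_apply, Function.comp_apply,
        (extChartAt J (φ m)).left_inv (by rw [extChartAt_source]; exact hx'.2)]
    rw [hmap] at this
    simpa [hm] using this
  filter_upwards [(continuousAt_extChartAt (I := J) (φ m)).tendsto.eventually key,
    extChartAt_source_mem_nhds (I := J) (φ m)] with y hy hys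
  rwa [(extChartAt J (φ m)).left_inv hys] at hy

/-- A `C^n` function on a manifold whose derivative vanishes on the kernel of the derivative of a
submersion factors locally through the submersion, with a `C^n` factor. -/
theorem ContMDiff.exists_local_factor_of_mfderiv_ker (hn : 1 ≤ n)
    [IsManifold I n M] [IsManifold J n N] {φ : M → N} (hφ : ContMDiff I J n φ)
    {F : M → G} (hF : ContMDiff I 𝓘(ℝ, G) n F) {m : M}
    (hsurj : Function.Surjective (mfderiv I J φ m))
    (hker : ∀ x v, mfderiv I J φ x v = 0 → mfderiv I 𝓘(ℝ, G) F x v = 0) :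
    ∃ g : N → G, ContMDiffAt J 𝓘(ℝ, G) n g (φ m) ∧ F =ᶠ[𝓝 m] g ∘ φ := by
  have : IsManifold I 1 M := IsManifold.of_le hn
  have : IsManifold J 1 N := IsManifold.of_le hn
  have hn0 : n ≠ 0 := (lt_of_lt_of_le zero_lt_one hn).ne'
  have hm : (extChartAt I m).symm (extChartAt I m m) = m := extChartAt_to_inv m
  have hFc : ContDiffAt ℝ n (F ∘ (extChartAt I m).symm) (extChartAt I m m) :=
    ContMDiffAt.contDiffAt (hF.contMDiffAt.comp _
      (contMDiffAt_extChartAt_symm_of_mem_target m (mem_extChartAt_target m)))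
  obtain ⟨g, hg, hgF⟩ := (contDiffAt_extChartAt_comp (hφ m)).exists_factor_of_fderiv_ker hn hFc
    (surjective_fderiv_extChartAt_comp (hφ.mdifferentiable hn0 m) hsurj) <| by
      filter_upwards [eventually_mem_target_and_mem_source (H' := H') (hφ m).continuousAt]
        with x hx v hv
      rw [fderiv_extChartAt_comp m hx.1 (hφ.mdifferentiable hn0 _) hx.2] at hv
      have h0 := hker _ _ ((isInvertible_mfderiv_extChartAt
        (by rw [extChartAt_source]; exact hx.2)).injective (hv.trans (map_zero _).symm))
      rw [← mfderiv_eq_fderiv, mfderiv_comp x (hF.mdifferentiable hn0 _)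
        ((contMDiffAt_extChartAt_symm_of_mem_target (n := n) m hx.1).mdifferentiableAt hn0)]
      exact h0
  refine ⟨g ∘ extChartAt J (φ m), ContMDiffAt.comp _ ?_ contMDiffAt_extChartAt, ?_⟩
  · simpa [hm] using hg.contMDiffAt
  · filter_upwards [(continuousAt_extChartAt (I := I) m).tendsto.eventually hgF,
      extChartAt_source_mem_nhds (I := I) m] with x hx hxs
    simpa only [Function.comp_apply, (extChartAt I m).left_inv hxs] using hx

/-- A `C^n` function whose derivative vanishes on the kernel of the derivative of a surjective
submersion with connected fibers descends to a `C^n` function on the base. -/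
theorem ContMDiff.exists_factor_of_mfderiv_ker [J.Boundaryless] (hn : 1 ≤ n)
    [IsManifold I n M] [IsManifold J n N] {φ : M → N} (hφ : ContMDiff I J n φ)
    (hφs : Function.Surjective φ) (hsurj : ∀ x, Function.Surjective (mfderiv I J φ x))
    (hconn : ∀ y, IsPreconnected (φ ⁻¹' {y}))
    {F : M → G} (hF : ContMDiff I 𝓘(ℝ, G) n F)
    (hker : ∀ x v, mfderiv I J φ x v = 0 → mfderiv I 𝓘(ℝ, G) F x v = 0) :
    ∃ g : N → G, ContMDiff J 𝓘(ℝ, G) n g ∧ ∀ x, F x = g (φ x) := by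
  have : IsManifold I 1 M := IsManifold.of_le hn
  have : IsManifold J 1 N := IsManifold.of_le hn
  have hloc := fun m => hφ.exists_local_factor_of_mfderiv_ker hn hF (hsurj m) hker
  have hfib : ∀ x y, φ x = φ y → F x = F y := fun x y hxy => by
    have := isPreconnected_iff_preconnectedSpace.1 (hconn (φ y))
    have hlc : IsLocallyConstant fun z : φ ⁻¹' {φ y} => F z := by
      rw [IsLocallyConstant.iff_eventually_eq]
      intro z
      obtain ⟨g, -, hg⟩ := hloc z
      filter_upwards [continuous_subtype_val.continuousAt.eventually hg] with w hw
      have hwz : φ w = φ z := w.2.trans z.2.symm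
      rw [hw, hg.self_of_nhds, Function.comp_apply, Function.comp_apply, hwz]
    exact hlc.apply_eq_of_preconnectedSpace ⟨x, hxy⟩ ⟨y, rfl⟩
  have hfac : ∀ x, F x = F (Function.surjInv hφs (φ x)) := fun x =>
    hfib _ _ (Function.surjInv_eq hφs _).symm
  refine ⟨fun y => F (Function.surjInv hφs y), fun y => ?_, hfac⟩
  obtain ⟨m, rfl⟩ := hφs y
  obtain ⟨g, hg, hgF⟩ := hloc m
  refine hg.congr_of_eventuallyEq <|
    ((hφ m).of_le hn).nhds_le_map_of_surjective_mfderiv (hsurj m) ?_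
  refine mem_map.2 (hgF.mono fun x hx => ?_)
  exact (hfac x).symm.trans hx

end Submersion

/-- If the Hamiltonian derivation given by `g` annihilates every `u i`, it annihilates the bracket
of the `u i`. -/
theorem bracket_eq_zero_of_forall_bracket_eq_zero {V : Type*} [AddCommGroup V] [Module ℝ V]
    {p : ℕ} (B : AlternatingMap ℝ V V (Fin (p + 1))) (hB : FundamentalIdentity ⇑B)
    {g : Fin p → V} {u : Fin (p + 1) → V} (hu : ∀ i, B (Fin.snoc g (u i)) = 0) :
    B (Fin.snoc g (B u)) = 0 := by
  rw [hB g u]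
  exact Finset.sum_eq_zero fun k _ => by rw [hu k, B.map_update_zero]

theorem mfderiv_eq_zero_of_mem_span {E : Type*} [NormedAddCommGroup E] [NormedSpace ℝ E]
    {H : Type*} [TopologicalSpace H] {I : ModelWithCorners ℝ E H}
    {M : Type*} [TopologicalSpace M] [ChartedSpace H M] {F : M → ℝ} {x : M}
    {S : Set (TangentSpace I x)} (hS : ∀ w ∈ S, mfderiv I 𝓘(ℝ, ℝ) F x w = 0)
    {v : TangentSpace I x} (hv : v ∈ Submodule.span ℝ S) : mfderiv I 𝓘(ℝ, ℝ) F x v = 0 :=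
  (Submodule.span_le (p := (mfderiv I 𝓘(ℝ, ℝ) F x).ker)).2 hS hv

/-- let `(M, {·}_M)` be a Nambu-Poisson manifold of order `n = q+2 ≥ 2` and let
`φ : M → N` be a surjective submersion with connected fibers such that, at every point `m`,
the kernel of `mfderiv φ m` is contained in the `ℝ`-linear span of the Hamiltonian tangent
vectors at `m` tangent to the fibers of `φ`.  Then there exists a (unique) Nambu-Poisson
bracket of order `n` on `C^∞(N;ℝ)` coinduced by `φ`. -/
theorem coinduced_nambu_structure_of_hamiltonian_kernel
    {E : Type*} [NormedAddCommGroup E] [NormedSpace ℝ E] [FiniteDimensional ℝ E]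
    {H : Type*} [TopologicalSpace H] {I : ModelWithCorners ℝ E H} [I.Boundaryless]
    {M : Type*} [TopologicalSpace M] [ChartedSpace H M] [IsManifold I ∞ M]
    {E' : Type*} [NormedAddCommGroup E'] [NormedSpace ℝ E'] [FiniteDimensional ℝ E']
    {H' : Type*} [TopologicalSpace H'] {J : ModelWithCorners ℝ E' H'} [J.Boundaryless]
    {N : Type*} [TopologicalSpace N] [ChartedSpace H' N] [IsManifold J ∞ N]
    {q : ℕ}
    (BM : AlternatingMap ℝ C^∞⟮I, M; ℝ⟯ C^∞⟮I, M; ℝ⟯ (Fin (q + 2)))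
    (hLeibM : LeibnizRule ⇑BM) (hFIM : FundamentalIdentity ⇑BM)
    (φ : C^∞⟮I, M; J, N⟯) (hsurj : Function.Surjective φ)
    (hsubm : ∀ x : M, Function.Surjective (mfderiv I J φ x))
    (hconn : ∀ y : N, IsConnected (⇑φ ⁻¹' {y}))
    (hker : ∀ m : M, ∀ v : TangentSpace I m, mfderiv I J φ m v = 0 →
      v ∈ Submodule.span ℝ
        {w : TangentSpace I m |
          ∃ g : Fin (q + 1) → C^∞⟮I, M; ℝ⟯,
            (∀ f : C^∞⟮J, N; ℝ⟯, BM (Fin.snoc g (f.comp φ)) = 0) ∧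
            ∀ h : C^∞⟮I, M; ℝ⟯,
              mfderiv I 𝓘(ℝ, ℝ) h m w = BM (Fin.snoc g h) m}) :
    ∃! BN : AlternatingMap ℝ C^∞⟮J, N; ℝ⟯ C^∞⟮J, N; ℝ⟯ (Fin (q + 2)),
      LeibnizRule ⇑BN ∧ FundamentalIdentity ⇑BN ∧
      ∀ f : Fin (q + 2) → C^∞⟮J, N; ℝ⟯, ∀ x : M,
        BM (fun i => (f i).comp φ) x = BN f (φ x) := by
  have hdesc : ∀ f : Fin (q + 2) → C^∞⟮J, N; ℝ⟯, ∃ G : C^∞⟮J, N; ℝ⟯,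
      BM (fun i => (f i).comp φ) = G.comp φ := fun f => by
    obtain ⟨G, hG, hGF⟩ := φ.contMDiff.exists_factor_of_mfderiv_ker (by simp) hsurj hsubm
      (fun y => (hconn y).isPreconnected) (BM fun i => (f i).comp φ).contMDiff
      (fun x v hv => by
        refine mfderiv_eq_zero_of_mem_span ?_ (hker x v hv)
        rintro w ⟨g, hg, hw⟩
        rw [hw, bracket_eq_zero_of_forall_bracket_eq_zero BM hFIM fun i => hg (f i)]
        rfl)
    exact ⟨⟨G, hG⟩, ContMDiffMap.ext hGF⟩
  have hinj : ∀ {a b : C^∞⟮J, N; ℝ⟯}, a.comp φ = b.comp φ → a = b := fun {a b} hab =>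
    ContMDiffMap.ext fun y => by
      obtain ⟨x, rfl⟩ := hsurj y
      exact DFunLike.congr_fun hab x
  have hupd : ∀ [DecidableEq (Fin (q + 2))] (f : Fin (q + 2) → C^∞⟮J, N; ℝ⟯) i a,
      (fun j => (Function.update f i a j).comp φ) =
        Function.update (fun j => (f j).comp φ) i (a.comp φ) := fun f i a => by
    ext1 j
    exact Function.apply_update (fun _ (u : C^∞⟮J, N; ℝ⟯) => u.comp φ) f i a j
  have hsnoc : ∀ (f : Fin (q + 1) → C^∞⟮J, N; ℝ⟯) a,
      (fun j => ((Fin.snoc f a : Fin (q + 2) → C^∞⟮J, N; ℝ⟯) j).comp φ) =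
        Fin.snoc (fun j => (f j).comp φ) (a.comp φ) := fun f a => by
    ext1 j
    refine Fin.lastCases ?_ (fun j => ?_) j <;> simp
  choose B hB using hdesc
  let BN : AlternatingMap ℝ C^∞⟮J, N; ℝ⟯ C^∞⟮J, N; ℝ⟯ (Fin (q + 2)) :=
    { toFun := B
      map_update_add' := fun f i a b => hinj <| by
        have hadd : ∀ a b : C^∞⟮J, N; ℝ⟯, (a + b).comp φ = a.comp φ + b.comp φ := fun _ _ => rfl
        simp only [hadd, ← hB, hupd, BM.map_update_add]
      map_update_smul' := fun f i c a => hinj <| by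
        have hsmul : ∀ a : C^∞⟮J, N; ℝ⟯, (c • a).comp φ = c • a.comp φ := fun _ => rfl
        simp only [hsmul, ← hB, hupd, BM.map_update_smul]
      map_eq_zero_of_eq' := fun f i j hij hne => hinj <| by
        rw [← hB, BM.map_eq_zero_of_eq _ (congrArg (fun u : C^∞⟮J, N; ℝ⟯ => u.comp φ) hij) hne]
        rfl }
  have hBN : ∀ f, BM (fun i => (f i).comp φ) = (BN f).comp φ := hB
  refine ⟨BN, ⟨fun f i a b => hinj ?_, fun f g => hinj ?_, fun f x => ?_⟩, ?_⟩
  · have hring : ∀ a b c d : C^∞⟮J, N; ℝ⟯,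
        (a * b + c * d).comp φ = a.comp φ * b.comp φ + c.comp φ * d.comp φ := fun _ _ _ _ => rfl
    rw [hring, ← hBN, ← hBN, ← hBN, hupd, hupd, hupd]
    exact hLeibM _ i (a.comp φ) (b.comp φ)
  · have hsum : ∀ u : Fin (q + 2) → C^∞⟮J, N; ℝ⟯, (∑ k, u k).comp φ = ∑ k, (u k).comp φ :=
      fun u => map_sum (AddMonoidHom.mk' (fun a : C^∞⟮J, N; ℝ⟯ => a.comp φ) fun _ _ => rfl) u _
    simp only [hsum, ← hBN, hsnoc, hupd]
    exact hFIM _ _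
  · rw [hBN]
    rfl
  · rintro B' ⟨-, -, hB'⟩
    refine AlternatingMap.ext fun f => hinj <| ContMDiffMap.ext fun x => ?_
    rw [← hBN]
    exact (hB' f x).symm
end

section
/- Let M be a smooth finite-dimensional Hausdorff manifold without boundary equipped with a Nambu-Poisson bracket {·,…,·} of order n (n ≥ 2), and let m₀ ∈ M be a point at which the Nambu tensor vanishes, i.e. {f_1,…,f_n}(m₀) = 0 for all f_1,…,f_n ∈ C^∞(M;ℝ). Then: (a) whenever f_1,…,f_n, g_1,…,g_n ∈ C^∞(M;ℝ) satisfy mfderiv f_k m₀ = mfderiv g_k m₀ for all k, one has mfderiv {f_1,…,f_n} m₀ = mfderiv {g_1,…,g_n} m₀; consequently (b) there is a unique alternating n-multilinear bracket [·,…,·] on the cotangent space T^*_{m₀}M with [d_{m₀}f_1,…,d_{m₀}f_n] = d_{m₀}{f_1,…,f_n} for all f_i ∈ C^∞(M;ℝ), and this bracket satisfies the Fundamental (Filippov) identity, making T^*_{m₀}M a Filippov algebra of order n. -/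
open scoped Manifold
local notation "∞" => (⊤ : ℕ∞)

section Hadamard

variable {E F : Type*} [NormedAddCommGroup E] [NormedSpace ℝ E]
  [NormedAddCommGroup F] [NormedSpace ℝ F]

open MeasureTheory Set in
/-- The integral over `[0, 1]` of a smooth function depending smoothly on a parameter is smooth in
the parameter. -/
theorem contDiff_intervalIntegral_of_contDiff {G : E × ℝ → F} (hG : ContDiff ℝ ∞ G) :
    ContDiff ℝ ∞ fun x => ∫ t in (0 : ℝ)..1, G (x, t) := by
  let ρ : ContDiffBump (0 : ℝ) := ⟨1, 2, one_pos, one_lt_two⟩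
  have key := contDiffOn_convolution_right_with_param_comp (μ := (volume : Measure ℝ)) (n := ⊤)
    (ContinuousLinearMap.lsmul ℝ ℝ : ℝ →L[ℝ] F →L[ℝ] F) (s := (univ : Set E))
    (v := fun _ => (0 : ℝ)) contDiffOn_const (f := indicator (Ioc (0 : ℝ) 1) fun _ => 1)
    (g := fun x t => ρ t • G (x, -t)) (k := Metric.closedBall 0 2) isOpen_univ
    (isCompact_closedBall _ _)
    (fun x t _ ht => by
      have : ρ t = 0 := ρ.zero_of_le_dist (le_of_lt (by simpa using ht))
      simp [this])
    ((integrable_indicator_iff measurableSet_Ioc).2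
      (integrableOn_const (by simp))).locallyIntegrable
    (ContDiff.contDiffOn <| by
      exact (ρ.contDiff.comp contDiff_snd).smul
        (hG.comp (contDiff_fst.prodMk contDiff_snd.neg)))
  refine (congrArg (ContDiff ℝ ∞) (funext fun x => ?_)).mpr (contDiffOn_univ.1 key)
  rw [intervalIntegral.integral_of_le zero_le_one, convolution_def,
    ← integral_indicator measurableSet_Ioc]
  refine integral_congr_ae (Filter.Eventually.of_forall fun t => ?_)
  by_cases ht : t ∈ Ioc (0 : ℝ) 1
  · have : ρ (-t) = 1 := ρ.one_of_mem_closedBall (by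
      simpa [ρ, abs_le] using ⟨by linarith [ht.1], ht.2⟩)
    simp [ht, this]
  · simp [ht]

/-- The Hadamard lemma: `f y = f p + G y (y - p)` with `G` smooth and `G p` the derivative of `f`
at `p`. -/
theorem ContDiff.exists_eq_add_apply_sub [CompleteSpace F] {f : E → F}
    (hf : ContDiff ℝ ∞ f) (p : E) :
    ∃ G : E → E →L[ℝ] F, ContDiff ℝ ∞ G ∧ G p = fderiv ℝ f p ∧
      ∀ y, f y = f p + G y (y - p) := by
  have hf' : ContDiff ℝ ∞ (fderiv ℝ f) := hf.fderiv_right (by simp)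
  refine ⟨fun y => ∫ t in (0 : ℝ)..1, fderiv ℝ f (p + t • (y - p)),
    contDiff_intervalIntegral_of_contDiff
      (G := fun z : E × ℝ => fderiv ℝ f (p + z.2 • (z.1 - p))) (hf'.comp (by fun_prop)),
    by simp, fun y => ?_⟩
  have hc : Continuous fun t : ℝ => fderiv ℝ f (p + t • (y - p)) :=
    hf'.continuous.comp (by fun_prop)
  dsimp only
  rw [ContinuousLinearMap.intervalIntegral_apply (hc.intervalIntegrable _ _),
    intervalIntegral.integral_eq_sub_of_hasDerivAt (f := fun t : ℝ => f (p + t • (y - p)))]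
  · simp
  · intro t _
    have h1 : HasDerivAt (fun t : ℝ => p + t • (y - p)) (y - p) t := by
      simpa using ((hasDerivAt_id t).smul_const (y - p)).const_add p
    exact (hf.differentiable (by simp) _).hasFDerivAt.comp_hasDerivAt t h1
  · exact (hc.clm_apply continuous_const).intervalIntegrable _ _

end Hadamard

section Algebra

variable {R A V : Type*} [CommRing R] [AddCommGroup A] [Module R A] [AddCommGroup V] [Module R V]

/-- A multilinear map which vanishes as soon as one argument lies in the kernel of `d` depends only
on the images of its arguments under `d`. -/
theorem MultilinearMap.eq_of_map_eq {W ι : Type*} [Fintype ι] [DecidableEq ι]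
    [AddCommGroup W] [Module R W] (Φ : MultilinearMap R (fun _ : ι => A) W) (d : A →ₗ[R] V)
    (h : ∀ (v : ι → A) (i : ι) (a : A), d a = 0 → Φ (Function.update v i a) = 0)
    {f g : ι → A} (hfg : ∀ i, d (f i) = d (g i)) : Φ f = Φ g := by
  have key : ∀ s : Finset ι, Φ (s.piecewise f g) = Φ g := by
    intro s
    induction s using Finset.induction_on with
    | empty => simp
    | insert i s hi ih =>
      have hg : Function.update (s.piecewise f g) i (g i) = s.piecewise f g := by
        rw [Function.update_eq_self_iff]; simp [hi]
      rw [Finset.piecewise_insert, ← sub_eq_zero, ← ih]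
      nth_rw 2 [← hg]
      rw [← Φ.map_update_sub]
      exact h _ _ _ (by rw [map_sub, hfg, sub_self])
  simpa using key Finset.univ

/-- An alternating bracket satisfying the Fundamental identity descends along a surjective linear
map `d` as soon as `d (B v)` depends only on the images of the arguments. -/
theorem AlternatingMap.existsUnique_fundamentalIdentity_of_surjective {p : ℕ}
    (B : AlternatingMap R A A (Fin (p + 1))) (hFI : FundamentalIdentity ⇑B)
    (d : A →ₗ[R] V) (s : V →ₗ[R] A) (hs : ∀ x, d (s x) = x)
    (hd : ∀ f g : Fin (p + 1) → A, (∀ k, d (f k) = d (g k)) → d (B f) = d (B g)) :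
    ∃! L : AlternatingMap R V V (Fin (p + 1)),
      (∀ f : Fin (p + 1) → A, L (fun k => d (f k)) = d (B f)) ∧ FundamentalIdentity ⇑L := by
  let L : AlternatingMap R V V (Fin (p + 1)) := d.compAlternatingMap (B.compLinearMap s)
  have hL : ∀ f : Fin (p + 1) → A, L (fun k => d (f k)) = d (B f) := fun f =>
    hd _ _ fun k => hs _
  refine ⟨L, ⟨hL, fun f g => ?_⟩, fun L' hL' => ?_⟩
  · have hsnoc : ∀ a : A, (fun k => d ((Fin.snoc (fun j => s (f j)) a : Fin (p + 1) → A) k)) =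
        (Fin.snoc f (d a) : Fin (p + 1) → V) := by
      intro a
      ext k
      refine Fin.lastCases ?_ (fun j => ?_) k <;> simp [hs]
    have hupd : ∀ (k : Fin (p + 1)) (a : A),
        (fun j => d (Function.update (fun j => s (g j)) k a j)) = Function.update g k (d a) := by
      intro k a
      ext j
      by_cases hj : j = k
      · subst hj; simp
      · simp [hj, hs]
    have hg : L g = d (B fun j => s (g j)) := rfl
    have hf : ∀ k, L (Fin.snoc f (g k)) = d (B (Fin.snoc (fun j => s (f j)) (s (g k)))) := by
      intro k
      rw [← hL, hsnoc, hs]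
    simp_rw [hf, hg, ← hupd, ← hsnoc, hL]
    rw [hFI, map_sum]
  · ext v
    have := hL'.1 fun k => s (v k)
    simp_rw [hs] at this
    exact this

end Algebra

namespace ContMDiffMap

variable {E : Type*} [NormedAddCommGroup E] [NormedSpace ℝ E]
  {H : Type*} [TopologicalSpace H] {I : ModelWithCorners ℝ E H}
  {M : Type*} [TopologicalSpace M] [ChartedSpace H M]

theorem mdifferentiableAt_top (f : C^∞⟮I, M; ℝ⟯) (m₀ : M) :
    MDifferentiableAt I 𝓘(ℝ, ℝ) f m₀ :=
  f.contMDiff.mdifferentiable (by simp) m₀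

/-- The differential at a point, as a linear map on smooth functions. -/
noncomputable def differentialAt (I : ModelWithCorners ℝ E H) (m₀ : M) :
    C^∞⟮I, M; ℝ⟯ →ₗ[ℝ] (TangentSpace I m₀ →L[ℝ] ℝ) where
  toFun f := mfderiv I 𝓘(ℝ, ℝ) f m₀
  map_add' f g := mfderiv_add (f.mdifferentiableAt_top m₀) (g.mdifferentiableAt_top m₀)
  map_smul' c f := const_smul_mfderiv (f.mdifferentiableAt_top m₀) c

theorem differentialAt_mul (m₀ : M) (f g : C^∞⟮I, M; ℝ⟯) :
    differentialAt I m₀ (f * g) =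
      f m₀ • differentialAt I m₀ g + g m₀ • differentialAt I m₀ f :=
  ((f.mdifferentiableAt_top m₀).hasMFDerivAt.mul (g.mdifferentiableAt_top m₀).hasMFDerivAt).mfderiv

/-- The ideal of smooth functions vanishing at a point. -/
noncomputable def vanishingIdealAt (I : ModelWithCorners ℝ E H) (m₀ : M) :
    Ideal C^∞⟮I, M; ℝ⟯ :=
  RingHom.ker ((Pi.evalRingHom (fun _ : M => ℝ) m₀).comp ContMDiffMap.coeFnRingHom)

theorem mem_vanishingIdealAt {m₀ : M} {f : C^∞⟮I, M; ℝ⟯} :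
    f ∈ vanishingIdealAt I m₀ ↔ f m₀ = 0 := Iff.rfl

variable [FiniteDimensional ℝ E] [IsManifold I ∞ M] [T2Space M]

/-- Cut off the pullback of a smooth function under a chart by a bump function. -/
noncomputable def cutoff {m₀ : M} (χ : SmoothBumpFunction I m₀) (φ : E → ℝ)
    (hφ : ContDiff ℝ ∞ φ) : C^∞⟮I, M; ℝ⟯ :=
  ⟨fun x => χ x • φ (extChartAt I m₀ x),
    χ.contMDiff_smul (hφ.contMDiff.comp_contMDiffOn contMDiffOn_extChartAt)⟩

theorem cutoff_apply {m₀ : M} (χ : SmoothBumpFunction I m₀) (φ : E → ℝ)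
    (hφ : ContDiff ℝ ∞ φ) (x : M) : cutoff χ φ hφ x = χ x * φ (extChartAt I m₀ x) := rfl

/-- Every covector at `m₀` is the differential of a smooth function. -/
theorem differentialAt_surjective (m₀ : M) : Function.Surjective (differentialAt I m₀) := by
  intro ℓ
  let χ : SmoothBumpFunction I m₀ := Classical.arbitrary _
  let ℓ' : E →L[ℝ] ℝ := ℓ
  refine ⟨cutoff χ ℓ' ℓ'.contDiff, ?_⟩
  have h1 : (cutoff χ ℓ' ℓ'.contDiff : M → ℝ) =ᶠ[nhds m₀] ℓ' ∘ extChartAt I m₀ := by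
    filter_upwards [χ.eventuallyEq_one] with x hx
    rw [cutoff_apply, hx]; simp
  change mfderiv I 𝓘(ℝ, ℝ) (cutoff χ ℓ' ℓ'.contDiff) m₀ = ℓ
  rw [h1.mfderiv_eq]
  refine HasMFDerivAt.mfderiv ⟨?_, ?_⟩
  · exact ℓ'.continuous.continuousAt.comp (continuousAt_extChartAt m₀)
  · refine (ℓ'.hasFDerivAt.hasFDerivWithinAt (s := Set.range I)).congr_of_eventuallyEq ?_ ?_
    · filter_upwards [extChartAt_target_mem_nhdsWithin m₀] with y hy
      exact congrArg ℓ' ((extChartAt I m₀).right_inv hy)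
    · exact congrArg ℓ' ((extChartAt I m₀).right_inv (mem_extChartAt_target m₀))

variable [I.Boundaryless]

/-- A smooth function with vanishing differential at `m₀` is, up to a constant, in the square of
the ideal of functions vanishing at `m₀`. -/
theorem sub_algebraMap_mem_vanishingIdealAt_sq {m₀ : M} {f : C^∞⟮I, M; ℝ⟯}
    (hf : differentialAt I m₀ f = 0) :
    f - algebraMap ℝ _ (f m₀) ∈ vanishingIdealAt I m₀ ^ 2 := by
  let χ : SmoothBumpFunction I m₀ := Classical.arbitrary _
  set p := extChartAt I m₀ m₀ with hp
  set g : C^∞⟮I, M; ℝ⟯ := f - algebraMap ℝ _ (f m₀) with hg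
  have hg0 : g m₀ = 0 := sub_self (f m₀)
  have hdg : mfderiv I 𝓘(ℝ, ℝ) g m₀ = 0 := by
    have h1 : differentialAt I m₀ (algebraMap ℝ C^∞⟮I, M; ℝ⟯ (f m₀)) = 0 :=
      mfderiv_const (I := I) (I' := 𝓘(ℝ, ℝ)) (x := m₀) (c := f m₀)
    change differentialAt I m₀ g = 0
    rw [hg, map_sub, hf, h1, sub_zero]
  -- the cut-off local expression of `g` in the chart
  let F : E → ℝ := fun y => χ.toContDiffBump y * g ((extChartAt I m₀).symm y)
  have hball : Metric.closedBall p χ.rOut ⊆ (extChartAt I m₀).target := by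
    have := χ.closedBall_subset
    rwa [I.range_eq_univ, Set.inter_univ] at this
  have hloc : ContDiffOn ℝ ∞ (fun y => g ((extChartAt I m₀).symm y)) (extChartAt I m₀).target :=
    (g.contMDiff.comp_contMDiffOn (contMDiffOn_extChartAt_symm m₀)).contDiffOn
  have hF : ContDiff ℝ ∞ F := by
    rw [← contMDiff_iff_contDiff]
    refine contMDiff_of_tsupport fun y hy => ?_
    have hy' : y ∈ (extChartAt I m₀).target := by
      refine hball ?_
      rw [hp, ← χ.toContDiffBump.tsupport_eq]
      exact tsupport_mul_subset_left hy
    exact (χ.toContDiffBump.contDiffAt.mul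
      (hloc.contDiffAt ((isOpen_extChartAt_target m₀).mem_nhds hy'))).contMDiffAt
  have hFp : F p = 0 := by simp [F, hp, hg0]
  have hdF : fderiv ℝ F p = 0 := by
    have h1 : F =ᶠ[nhds p] writtenInExtChartAt I 𝓘(ℝ, ℝ) m₀ g := by
      filter_upwards [χ.toContDiffBump.eventuallyEq_one] with y hy
      change χ.toContDiffBump y * g ((extChartAt I m₀).symm y) = g ((extChartAt I m₀).symm y)
      rw [hy, Pi.one_apply, one_mul]
    rw [h1.fderiv_eq, ← fderivWithin_univ, ← I.range_eq_univ]
    exact (g.mdifferentiableAt_top m₀).mfderiv.symm.trans hdg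
  obtain ⟨G, hG, hGp, hGF⟩ := hF.exists_eq_add_apply_sub p
  let b := Module.finBasis ℝ E
  let x := fun i => cutoff χ (fun y => b.coord i (y - p))
    ((b.coord i).toContinuousLinearMap.contDiff.comp (contDiff_id.sub contDiff_const))
  let c := fun i => cutoff χ (fun y => G y (b i)) (hG.clm_apply contDiff_const)
  have hx : ∀ i z, x i z = χ z * b.coord i (extChartAt I m₀ z - p) := fun _ _ => rfl
  have hc : ∀ i z, c i z = χ z * G (extChartAt I m₀ z) (b i) := fun _ _ => rfl
  let χ' : C^∞⟮I, M; ℝ⟯ := ⟨χ, χ.contMDiff⟩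
  have hsum : g = (1 - χ' ^ 3) * g + ∑ i, x i * c i := by
    ext z
    have h1 : (∑ i, x i * c i : C^∞⟮I, M; ℝ⟯) z = ∑ i, x i z * c i z :=
      map_sum ((Pi.evalRingHom (fun _ : M => ℝ) z).comp ContMDiffMap.coeFnRingHom) _ _
    have h2 : χ z ^ 3 * g z = χ z ^ 2 * F (extChartAt I m₀ z) := by
      by_cases hz : z ∈ (chartAt H m₀).source
      · have h3 := χ.eqOn_source hz
        have h4 := (extChartAt I m₀).left_inv (by rwa [extChartAt_source])
        simp only [Function.comp_apply] at h3
        simp only [F, h4, ← h3]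
        ring
      · have : χ z = 0 := by rw [χ.coe_def]; simp [hz]
        simp [this]
    have h3 : F (extChartAt I m₀ z) =
        ∑ i, b.coord i (extChartAt I m₀ z - p) * G (extChartAt I m₀ z) (b i) := by
      rw [hGF, hFp, zero_add]
      conv_lhs => rw [← b.sum_repr (extChartAt I m₀ z - p)]
      simp
    have h4 : ((1 - χ' ^ 3) * g + ∑ i, x i * c i : C^∞⟮I, M; ℝ⟯) z =
        (1 - χ z ^ 3) * g z + (∑ i, x i * c i : C^∞⟮I, M; ℝ⟯) z := rfl
    rw [h4, h1, sub_mul, h2, h3, Finset.mul_sum]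
    simp only [hx, hc]
    rw [one_mul, sub_add, eq_comm, sub_eq_self, ← Finset.sum_sub_distrib]
    exact Finset.sum_eq_zero fun i _ => by ring
  rw [hsum, sq]
  refine add_mem (Ideal.mul_mem_mul ?_ hg0) (sum_mem fun i _ => Ideal.mul_mem_mul ?_ ?_)
  · change 1 - χ m₀ ^ 3 = 0
    simp
  · rw [mem_vanishingIdealAt, hx]
    simp [hp]
  · rw [mem_vanishingIdealAt, hc, ← hp, hGp, hdF]
    simp

/-- A derivation of the smooth functions whose values all vanish at `m₀` maps functions with
vanishing differential at `m₀` to functions with vanishing differential at `m₀`. -/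
theorem differentialAt_eq_zero_of_leibniz {m₀ : M} (D : C^∞⟮I, M; ℝ⟯ →ₗ[ℝ] C^∞⟮I, M; ℝ⟯)
    (hD : ∀ f g, D (f * g) = f * D g + D f * g) (hm₀ : ∀ f, D f m₀ = 0)
    {f : C^∞⟮I, M; ℝ⟯} (hf : differentialAt I m₀ f = 0) : differentialAt I m₀ (D f) = 0 := by
  have hsq : ∀ h ∈ vanishingIdealAt I m₀ ^ 2, differentialAt I m₀ (D h) = 0 := by
    intro h hh
    rw [sq] at hh
    refine Submodule.mul_induction_on hh (fun a ha b hb => ?_) fun a b ha hb => ?_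
    · rw [hD, map_add, differentialAt_mul, differentialAt_mul, hm₀, hm₀,
        mem_vanishingIdealAt.1 ha, mem_vanishingIdealAt.1 hb]
      simp
    · rw [map_add, map_add, ha, hb, add_zero]
  have h1 : D 1 = 0 := by simpa using hD 1 1
  have := hsq _ (sub_algebraMap_mem_vanishingIdealAt_sq hf)
  rwa [Algebra.algebraMap_eq_smul_one, map_sub, map_smul, h1, smul_zero, sub_zero] at this

end ContMDiffMap

/-- let `{·,…,·}` be a Nambu-Poisson bracket of order `n = q+2 ≥ 2` on a Hausdorff
smooth boundaryless manifold `M` and let `m₀ ∈ M` be a point at which the Nambu tensor vanishes.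
Then (a) `d_{m₀}{f₁,…,fₙ}` depends only on the differentials `d_{m₀}f_k`, and (b) there is a
unique alternating `n`-multilinear bracket on the cotangent space `T^*_{m₀}M` with
`[d_{m₀}f₁,…,d_{m₀}fₙ] = d_{m₀}{f₁,…,fₙ}`, and it satisfies the Fundamental (Filippov)
identity, making `T^*_{m₀}M` a Filippov algebra of order `n`. -/
theorem filippov_algebra_at_zero_of_nambu_tensor
    {E : Type*} [NormedAddCommGroup E] [NormedSpace ℝ E] [FiniteDimensional ℝ E]
    {H : Type*} [TopologicalSpace H] {I : ModelWithCorners ℝ E H} [I.Boundaryless]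
    {M : Type*} [TopologicalSpace M] [ChartedSpace H M] [IsManifold I ∞ M]
    [T2Space M] {q : ℕ}
    (B : AlternatingMap ℝ C^∞⟮I, M; ℝ⟯ C^∞⟮I, M; ℝ⟯ (Fin (q + 2)))
    (hLeib : LeibnizRule ⇑B) (hFI : FundamentalIdentity ⇑B)
    (m₀ : M) (hm₀ : ∀ f : Fin (q + 2) → C^∞⟮I, M; ℝ⟯, B f m₀ = 0) :
    (∀ f g : Fin (q + 2) → C^∞⟮I, M; ℝ⟯,
      (∀ k, mfderiv I 𝓘(ℝ, ℝ) (f k) m₀ = mfderiv I 𝓘(ℝ, ℝ) (g k) m₀) →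
      mfderiv I 𝓘(ℝ, ℝ) (B f) m₀ = mfderiv I 𝓘(ℝ, ℝ) (B g) m₀) ∧
    (∃! L : AlternatingMap ℝ (TangentSpace I m₀ →L[ℝ] ℝ) (TangentSpace I m₀ →L[ℝ] ℝ)
        (Fin (q + 2)),
      (∀ f : Fin (q + 2) → C^∞⟮I, M; ℝ⟯,
        L (fun k => mfderiv I 𝓘(ℝ, ℝ) (f k) m₀) = mfderiv I 𝓘(ℝ, ℝ) (B f) m₀) ∧
      FundamentalIdentity ⇑L) := by
  have hd : ∀ f g : Fin (q + 2) → C^∞⟮I, M; ℝ⟯,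
      (∀ k, ContMDiffMap.differentialAt I m₀ (f k) = ContMDiffMap.differentialAt I m₀ (g k)) →
      ContMDiffMap.differentialAt I m₀ (B f) = ContMDiffMap.differentialAt I m₀ (B g) :=
    fun f g hfg => MultilinearMap.eq_of_map_eq
      ((ContMDiffMap.differentialAt I m₀).compMultilinearMap B.toMultilinearMap)
      (ContMDiffMap.differentialAt I m₀)
      (fun v i _ ha => ContMDiffMap.differentialAt_eq_zero_of_leibniz
        (B.toMultilinearMap.toLinearMap v i) (hLeib v i) (fun _ => hm₀ _) ha) hfg
  obtain ⟨s, hs⟩ := (ContMDiffMap.differentialAt I m₀).exists_rightInverse_of_surjective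
    (LinearMap.range_eq_top.2 (ContMDiffMap.differentialAt_surjective m₀))
  exact ⟨hd, B.existsUnique_fundamentalIdentity_of_surjective hFI _ s
    (fun x => LinearMap.congr_fun hs x) hd⟩
end

section
/- Let G be a (finite-dimensional, boundaryless) Lie group and let {·,…,·} be an n-vector-field bracket on C^∞(G;ℝ) (n ≥ 2) that is multiplicative, in the sense that {f_1,…,f_n}(g·h) = {f_1∘r_h,…,f_n∘r_h}(g) + {f_1∘l_g,…,f_n∘l_g}(h) for all g, h ∈ G and all f_1,…,f_n ∈ C^∞(G;ℝ), where r_h(x) = x·h and l_g(x) = g·x (this encodes the multiplicativity condition Π(gh) = (r_h)_*Π(g) + (l_g)_*Π(h) of a Nambu-Lie group). Then: (a) the tensor vanishes at the identity, i.e. {f_1,…,f_n}(e) = 0 for all f_i; and (b) the group inversion i : G → G, i(g) = g^{-1}, satisfies i_*Π = (−1)^{n−1}Π, i.e. {f_1∘i,…,f_n∘i}(g) = (−1)^{n−1}{f_1,…,f_n}(g^{-1}) for all g ∈ G and all f_i ∈ C^∞(G;ℝ); in particular the inversion is an anti-Nambu-Poisson map. -/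
open scoped Manifold
local notation "∞" => (⊤ : ℕ∞)

section Translations

variable {E : Type*} [NormedAddCommGroup E] [NormedSpace ℝ E]
    {H : Type*} [TopologicalSpace H] {I : ModelWithCorners ℝ E H}
    {G : Type*} [TopologicalSpace G] [ChartedSpace H G] [Group G] [LieGroup I ∞ G]

/-- Right translation `r_h : x ↦ x * h` as a bundled smooth map. -/
def rightTranslation (h : G) : C^∞⟮I, G; I, G⟯ :=
  ⟨fun x => x * h, contMDiff_id.mul contMDiff_const⟩

/-- Left translation `l_g : x ↦ g * x` as a bundled smooth map. -/
def leftTranslation (g : G) : C^∞⟮I, G; I, G⟯ :=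
  ⟨fun x => g * x, contMDiff_const.mul contMDiff_id⟩

/-- Group inversion `i : g ↦ g⁻¹` as a bundled smooth map. -/
def inversionMap : C^∞⟮I, G; I, G⟯ :=
  ⟨fun x => x⁻¹, contMDiff_id.inv⟩

end Translations

section Hadamard

universe u

/-- Integration over `[0, 1]` preserves `C^n` dependence on a parameter, for finite `n`. -/
theorem contDiff_nat_integral_unitInterval {E : Type u} [NormedAddCommGroup E] [NormedSpace ℝ E]
    [FiniteDimensional ℝ E] (n : ℕ) {F : Type u} [NormedAddCommGroup F] [NormedSpace ℝ F]
    {f : E × ℝ → F} (hf : ContDiff ℝ n f) :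
    ContDiff ℝ n fun x => ∫ t in (0 : ℝ)..1, f (x, t) := by
  induction n generalizing F with
  | zero =>
    have hc : Continuous f := hf.continuous
    exact contDiff_zero.2 <|
      intervalIntegral.continuous_parametric_intervalIntegral_of_continuous'
        (f := fun x t => f (x, t)) hc 0 1
  | succ n ih =>
    have hc : Continuous f := hf.continuous
    have hf' : ContDiff ℝ n fun z => (fderiv ℝ f z).comp (ContinuousLinearMap.inl ℝ E ℝ) :=
      (hf.fderiv_right (m := n) (by norm_cast)).clm_comp contDiff_const
    have hc' := hf'.continuous
    have hd : Differentiable ℝ f := hf.differentiable (by simp)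
    rw [Nat.cast_succ, contDiff_succ_iff_hasFDerivAt]
    refine ⟨_, ih hf', fun x₀ => ?_⟩
    obtain ⟨C, hC⟩ := ((isCompact_closedBall x₀ 1).prod
      (isCompact_Icc (a := (0 : ℝ)) (b := 1))).exists_bound_of_continuousOn hc'.continuousOn
    refine intervalIntegral.hasFDerivAt_integral_of_dominated_of_fderiv_le
      (F := fun x t => f (x, t))
      (F' := fun x t => (fderiv ℝ f (x, t)).comp (ContinuousLinearMap.inl ℝ E ℝ))
      (bound := fun _ => C) (Metric.closedBall_mem_nhds x₀ one_pos)
      (.of_forall fun x =>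
        (hc.comp (by fun_prop : Continuous fun t : ℝ => (x, t))).aestronglyMeasurable)
      ((hc.comp (by fun_prop : Continuous fun t : ℝ => (x₀, t))).intervalIntegrable 0 1)
      (hc'.comp (by fun_prop : Continuous fun t : ℝ => (x₀, t))).aestronglyMeasurable
      (.of_forall fun t ht x hx => ?_) intervalIntegrable_const
      (.of_forall fun t _ x _ => (hd (x, t)).hasFDerivAt.comp x (hasFDerivAt_prodMk_left x t))
    rw [Set.uIoc_of_le zero_le_one] at ht
    exact hC (x, t) ⟨hx, ht.1.le, ht.2⟩

/-- **Hadamard's lemma**: a smooth function `w` vanishing at `y₀` is of the form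
`y ↦ A y (y - y₀)`, where `A` is smooth and `A y₀` is the derivative of `w` at `y₀`. -/
theorem exists_contDiff_eq_apply_sub {E : Type u} [NormedAddCommGroup E] [NormedSpace ℝ E]
    [FiniteDimensional ℝ E] {w : E → ℝ} (hw : ContDiff ℝ ∞ w) {y₀ : E} (h₀ : w y₀ = 0) :
    ∃ A : E → E →L[ℝ] ℝ, ContDiff ℝ ∞ A ∧ A y₀ = fderiv ℝ w y₀ ∧ ∀ y, w y = A y (y - y₀) := by
  have hline : ContDiff ℝ ∞ fun z : E × ℝ => y₀ + z.2 • (z.1 - y₀) := by fun_prop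
  have hdw : ContDiff ℝ ∞ (fderiv ℝ w) := hw.fderiv_right (by simp)
  have hd : Differentiable ℝ w := hw.differentiable (by simp)
  refine ⟨fun y => ∫ t in (0 : ℝ)..1, fderiv ℝ w (y₀ + t • (y - y₀)),
    contDiff_iff_forall_nat_le.2 fun m hm => ?_, by simp, fun y => ?_⟩
  · exact contDiff_nat_integral_unitInterval m (f := fun z => fderiv ℝ w (y₀ + z.2 • (z.1 - y₀)))
      ((hdw.comp hline).of_le (by exact_mod_cast hm))
  · have hcont : Continuous fun t : ℝ => fderiv ℝ w (y₀ + t • (y - y₀)) :=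
      hdw.continuous.comp (by fun_prop)
    rw [ContinuousLinearMap.intervalIntegral_apply (hcont.intervalIntegrable 0 1),
      intervalIntegral.integral_eq_sub_of_hasDerivAt
        (f := fun t : ℝ => w (y₀ + t • (y - y₀))) (fun t _ => ?_)
        ((hcont.clm_apply continuous_const).intervalIntegrable 0 1)]
    · simp [h₀]
    · have hl : HasDerivAt (fun t : ℝ => y₀ + t • (y - y₀)) (y - y₀) t := by
        simpa using ((hasDerivAt_id t).smul_const (y - y₀)).const_add y₀
      exact (hd _).hasFDerivAt.comp_hasDerivAt t hl

end Hadamard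

section PointDerivation

variable {E : Type*} [NormedAddCommGroup E] [NormedSpace ℝ E]
    {H : Type*} [TopologicalSpace H] {I : ModelWithCorners ℝ E H}
    {M : Type*} [TopologicalSpace M] [ChartedSpace H M]

theorem pointDerivation_one {p : M} {D : C^∞⟮I, M; ℝ⟯ →ₗ[ℝ] ℝ}
    (hD : ∀ f g : C^∞⟮I, M; ℝ⟯, D (f * g) = f p * D g + D f * g p) : D 1 = 0 := by
  have h := hD 1 1
  simp only [mul_one, ContMDiffMap.coe_one, Pi.one_apply, one_mul] at h
  linarith

/-- In a chart, the product of a bump function with a smooth function is smooth. -/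
theorem SmoothBumpFunction.contDiff_mul_comp_extChartAt_symm [FiniteDimensional ℝ E]
    [I.Boundaryless] [IsManifold I ∞ M] {p : M} (χ : SmoothBumpFunction I p)
    {u : M → ℝ} (hu : ContMDiff I 𝓘(ℝ, ℝ) ∞ u) :
    ContDiff ℝ ∞ fun y => χ.toContDiffBump y * u ((extChartAt I p).symm y) := by
  rw [← contMDiff_iff_contDiff]
  refine contMDiff_of_tsupport fun y hy => ?_
  have hy' : y ∈ (extChartAt I p).target := by
    have := tsupport_mul_subset_left hy
    rw [χ.toContDiffBump.tsupport_eq] at this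
    exact χ.closedBall_subset ⟨this, by simp [I.range_eq_univ]⟩
  exact χ.toContDiffBump.contDiff.contDiffAt.contMDiffAt.mul
    ((hu _).comp y ((contMDiffOn_extChartAt_symm p).contMDiffAt
      ((isOpen_extChartAt_target p).mem_nhds hy')))

/-- A derivation at a point annihilates the smooth functions with vanishing differential there. -/
theorem pointDerivation_eq_zero_of_mfderiv_eq_zero [FiniteDimensional ℝ E]
    [I.Boundaryless] [IsManifold I ∞ M] [T2Space M] {p : M} {D : C^∞⟮I, M; ℝ⟯ →ₗ[ℝ] ℝ}
    (hD : ∀ f g : C^∞⟮I, M; ℝ⟯, D (f * g) = f p * D g + D f * g p)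
    {u : C^∞⟮I, M; ℝ⟯} (hu : mfderiv I 𝓘(ℝ, ℝ) u p = 0) : D u = 0 := by
  obtain ⟨χ⟩ : Nonempty (SmoothBumpFunction I p) := inferInstance
  let v : C^∞⟮I, M; ℝ⟯ := u - u p • 1
  have hv (x : M) : v x = u x - u p := by simp [v]
  have hvD : D v = D u := by simp [v, pointDerivation_one hD]
  set y₀ := extChartAt I p p
  have hsymm : (extChartAt I p).symm y₀ = p := extChartAt_to_inv p
  let w : E → ℝ := fun y => χ.toContDiffBump y * v ((extChartAt I p).symm y)
  have hw : ContDiff ℝ ∞ w := χ.contDiff_mul_comp_extChartAt_symm v.contMDiff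
  have hw₀ : w y₀ = 0 := by simp only [w, hsymm, hv, sub_self, mul_zero]
  have hdw : fderiv ℝ w y₀ = 0 := by
    have heq : w =ᶠ[nhds y₀] fun y => (u ∘ (extChartAt I p).symm) y - u p := by
      filter_upwards [χ.toContDiffBump.eventuallyEq_one] with y hy
      simp only [w, hy, hv, Pi.one_apply, one_mul, Function.comp_apply]
    have hum : MDifferentiableAt I 𝓘(ℝ, ℝ) u p := u.contMDiff.mdifferentiable (by simp) p
    rw [heq.fderiv_eq, fderiv_sub_const]
    have hu' := hum.hasMFDerivAt.2
    rw [hu, I.range_eq_univ] at hu'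
    have hu₀ : HasFDerivWithinAt (u ∘ (extChartAt I p).symm) (0 : E →L[ℝ] ℝ) Set.univ y₀ := hu'
    exact (hasFDerivWithinAt_univ.1 hu₀).fderiv
  obtain ⟨A, hA, hA₀, hwA⟩ := exists_contDiff_eq_apply_sub hw hw₀
  rw [hdw] at hA₀
  let b := Module.finBasis ℝ E
  have hchart : ContMDiffOn I 𝓘(ℝ, E) ∞ (extChartAt I p) (chartAt H p).source :=
    contMDiffOn_extChartAt
  let ξ : Fin (Module.finrank ℝ E) → C^∞⟮I, M; ℝ⟯ := fun i =>
    ⟨fun x => χ x • (LinearMap.toContinuousLinearMap (b.coord i)) (extChartAt I p x - y₀),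
      χ.contMDiff_smul ((ContDiff.contMDiff (by fun_prop :
        ContDiff ℝ ∞ fun y => (LinearMap.toContinuousLinearMap (b.coord i)) (y - y₀)))
          |>.comp_contMDiffOn hchart)⟩
  let a : Fin (Module.finrank ℝ E) → C^∞⟮I, M; ℝ⟯ := fun i =>
    ⟨fun x => χ x • A (extChartAt I p x) (b i),
      χ.contMDiff_smul ((ContDiff.contMDiff (hA.clm_apply contDiff_const)).comp_contMDiffOn
          hchart)⟩
  let X : C^∞⟮I, M; ℝ⟯ := ⟨χ, χ.contMDiff⟩
  have hX : X p = 1 := χ.eq_one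
  have hξ (i) : ξ i p = 0 := by
    change χ p * b.coord i (y₀ - y₀) = 0
    rw [sub_self, map_zero, mul_zero]
  have ha (i) : a i p = 0 := by
    change χ p * A y₀ (b i) = 0
    simp [hA₀]
  have hfactor : X * X * X * v = ∑ i, ξ i * a i := by
    ext x
    have hsum : (∑ i, ξ i * a i) x = ∑ i, ξ i x * a i x :=
      map_sum (ContMDiffMap.evalRingHom x : C^∞⟮I, M; ℝ⟯ →+* ℝ) (fun i => ξ i * a i) Finset.univ
    rw [hsum]
    change χ x * χ x * χ x * v x = ∑ i, (χ x * b.coord i (extChartAt I p x - y₀)) *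
      (χ x * A (extChartAt I p x) (b i))
    by_cases hx : x ∈ (chartAt H p).source
    · have h1 := hwA (extChartAt I p x)
      have h2 : w (extChartAt I p x) = χ x * v x := by
        simp only [w]
        rw [(extChartAt I p).left_inv (by rwa [extChartAt_source]), χ.eqOn_source hx]
        rfl
      have h3 : A (extChartAt I p x) (extChartAt I p x - y₀) =
          ∑ i, b.coord i (extChartAt I p x - y₀) * A (extChartAt I p x) (b i) := by
        conv_lhs => rw [← b.sum_repr (extChartAt I p x - y₀), map_sum]
        simp
      rw [mul_assoc, ← h2, h1, h3, Finset.mul_sum]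
      exact Finset.sum_congr rfl fun i _ => by ring
    · have : χ x = 0 := Function.notMem_support.1 fun h => hx (χ.support_subset_source h)
      simp [this]
  have hv₀ : v p = 0 := by simp [hv]
  have h := congrArg D hfactor
  rw [hD, map_sum, Finset.sum_eq_zero fun i _ => by rw [hD, hξ, ha]; ring] at h
  simpa [hX, hv₀, hvD] using h

end PointDerivation

/-- Replacing every entry of a multilinear form by one that is equal to it in each slot
does not change its value. -/
theorem MultilinearMap.eq_of_forall_map_update_eq {R V W ι : Type*} [CommSemiring R]
    [AddCommMonoid V] [AddCommMonoid W] [Module R V] [Module R W] [Fintype ι] [DecidableEq ι]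
    (T : MultilinearMap R (fun _ : ι => V) W) {f h : ι → V}
    (hT : ∀ v i, T (Function.update v i (f i)) = T (Function.update v i (h i))) : T f = T h := by
  have key (s : Finset ι) : T (s.piecewise h f) = T f := by
    induction s using Finset.induction_on with
    | empty => simp
    | insert i s hi ih =>
      rw [Finset.piecewise_insert, ← hT, ← ih]
      congr 1
      ext j
      by_cases hj : j = i
      · subst hj; simp [hi]
      · simp [hj]
  simpa using (key Finset.univ).symm

/-- The differential of `x ↦ x⁻¹` at `g` is opposite to that of `x ↦ g⁻¹ * x * g⁻¹`. -/
theorem mfderiv_comp_inversionMap_add_eq_zero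
    {E : Type*} [NormedAddCommGroup E] [NormedSpace ℝ E]
    {H : Type*} [TopologicalSpace H] {I : ModelWithCorners ℝ E H}
    {G : Type*} [TopologicalSpace G] [ChartedSpace H G] [Group G] [LieGroup I ∞ G]
    (f : C^∞⟮I, G; ℝ⟯) (g : G) :
    mfderiv I 𝓘(ℝ, ℝ) (f.comp inversionMap +
      (f.comp (leftTranslation g⁻¹)).comp (rightTranslation g⁻¹) : C^∞⟮I, G; ℝ⟯) g = 0 := by
  let φ : G × G → ℝ := fun z => f (z.1⁻¹ * (z.2 * g⁻¹))
  have hφ : ContMDiff (I.prod I) 𝓘(ℝ, ℝ) ∞ φ :=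
    f.contMDiff.comp (contMDiff_fst.inv.mul (contMDiff_snd.mul contMDiff_const))
  have hφd : MDifferentiableAt (I.prod I) 𝓘(ℝ, ℝ) φ (g, g) := hφ.mdifferentiable (by simp) _
  have hdiag : MDifferentiableAt I (I.prod I) (fun x : G => (x, x)) g :=
    mdifferentiableAt_id.prodMk mdifferentiableAt_id
  have hdiag' : mfderiv I (I.prod I) (fun x : G => (x, x)) g =
      (ContinuousLinearMap.id ℝ (TangentSpace I g)).prod
        (ContinuousLinearMap.id ℝ (TangentSpace I g)) := by
    have := mdifferentiableAt_id.mfderiv_prod (mdifferentiableAt_id (I := I) (x := g))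
    rwa [mfderiv_id] at this
  have hconst : φ ∘ (fun x : G => (x, x)) = fun _ => f g⁻¹ := by
    ext x; simp [φ]
  have hzero : mfderiv I 𝓘(ℝ, ℝ) (φ ∘ fun x : G => (x, x)) g = 0 := by
    rw [hconst]; exact mfderiv_const
  have hinv : (fun x : G => φ (x, g)) = f.comp inversionMap := by
    ext x; simp [φ]; rfl
  have hconj : (fun x : G => φ (g, x)) =
      (f.comp (leftTranslation g⁻¹)).comp (rightTranslation g⁻¹) := rfl
  have hmd (k : C^∞⟮I, G; ℝ⟯) : MDifferentiableAt I 𝓘(ℝ, ℝ) k g :=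
    k.contMDiff.mdifferentiable (by simp) g
  rw [ContMDiffMap.coe_add, mfderiv_add (hmd _) (hmd _), ← hinv, ← hconj]
  rw [mfderiv_comp (f := fun x : G => (x, x)) g hφd hdiag, hdiag'] at hzero
  ext t
  have ht := congrArg (fun L => L t) hzero
  exact (mfderiv_prod_eq_add_apply (I := I) (I' := I)
    (v := ((t, t) : TangentSpace I g × TangentSpace I g)) hφd).symm.trans ht

/-- let `G` be a Lie group with a multiplicative `n`-vector-field bracket
(`n ≥ 2`, alternating, `ℝ`-multilinear, Leibniz), i.e.
`{f₁,…,fₙ}(g·h) = {f₁∘r_h,…,fₙ∘r_h}(g) + {f₁∘l_g,…,fₙ∘l_g}(h)`.  Then (a) the tensor vanishes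
at the identity, and (b) inversion satisfies `i_*Π = (−1)^{n−1}Π`, i.e.
`{f₁∘i,…,fₙ∘i}(g) = (−1)^{n−1}{f₁,…,fₙ}(g⁻¹)`; in particular inversion is an
anti-Nambu-Poisson map. -/
theorem multiplicative_bracket_vanishes_at_one_and_inversion_anti
    {E : Type*} [NormedAddCommGroup E] [NormedSpace ℝ E] [FiniteDimensional ℝ E]
    {H : Type*} [TopologicalSpace H] {I : ModelWithCorners ℝ E H} [I.Boundaryless]
    {G : Type*} [TopologicalSpace G] [ChartedSpace H G] [Group G] [LieGroup I ∞ G]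
    {n : ℕ} (hn : 2 ≤ n)
    (B : AlternatingMap ℝ C^∞⟮I, G; ℝ⟯ C^∞⟮I, G; ℝ⟯ (Fin n))
    (hLeib : ∀ (v : Fin n → C^∞⟮I, G; ℝ⟯) (i : Fin n) (f g : C^∞⟮I, G; ℝ⟯),
      B (Function.update v i (f * g)) =
        f * B (Function.update v i g) + B (Function.update v i f) * g)
    (hmult : ∀ (g h : G) (f : Fin n → C^∞⟮I, G; ℝ⟯),
      B f (g * h) =
        B (fun i => (f i).comp (rightTranslation h)) g +
          B (fun i => (f i).comp (leftTranslation g)) h) :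
    (∀ f : Fin n → C^∞⟮I, G; ℝ⟯, B f (1 : G) = 0) ∧
    (∀ (g : G) (f : Fin n → C^∞⟮I, G; ℝ⟯),
      B (fun i => (f i).comp inversionMap) g = (-1 : ℝ) ^ (n - 1) * B f g⁻¹) := by
  have : T1Space G := I.t1Space G
  have : IsTopologicalGroup G := topologicalGroup_of_lieGroup I ∞
  have : IsManifold I ∞ G := LieGroup.toContMDiffMul.toIsManifold
  have hone (f : Fin n → C^∞⟮I, G; ℝ⟯) : B f (1 : G) = 0 := by
    have h := hmult 1 1 f
    have hr (k : C^∞⟮I, G; ℝ⟯) : k.comp (rightTranslation 1) = k := by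
      ext x; exact congrArg k (mul_one x)
    have hl (k : C^∞⟮I, G; ℝ⟯) : k.comp (leftTranslation 1) = k := by
      ext x; exact congrArg k (one_mul x)
    simp only [hr, hl, mul_one] at h
    linarith
  refine ⟨hone, fun g f => ?_⟩
  let ev : C^∞⟮I, G; ℝ⟯ →ₗ[ℝ] ℝ :=
    { toFun := fun k => k g, map_add' := fun _ _ => rfl, map_smul' := fun _ _ => rfl }
  let T : MultilinearMap ℝ (fun _ : Fin n => C^∞⟮I, G; ℝ⟯) ℝ :=
    ev.compMultilinearMap B.toMultilinearMap
  let h : Fin n → C^∞⟮I, G; ℝ⟯ := fun i =>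
    ((f i).comp (leftTranslation g⁻¹)).comp (rightTranslation g⁻¹)
  have hinv : T (fun i => (f i).comp inversionMap) = T (fun i => (-1 : ℝ) • h i) := by
    refine T.eq_of_forall_map_update_eq fun v i => ?_
    have hD : T.toLinearMap v i ((f i).comp inversionMap + h i) = 0 :=
      pointDerivation_eq_zero_of_mfderiv_eq_zero (p := g)
        (fun k l => congrArg (fun b : C^∞⟮I, G; ℝ⟯ => b g) (hLeib v i k l))
        (mfderiv_comp_inversionMap_add_eq_zero (f i) g)
    rw [map_add] at hD
    rw [T.map_update_smul]
    simp only [MultilinearMap.toLinearMap_apply] at hD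
    rw [smul_eq_mul]
    linarith
  have hmul : T h = -B f g⁻¹ := by
    have hm := hmult g g⁻¹ fun i => (f i).comp (leftTranslation g⁻¹)
    have hl (k : C^∞⟮I, G; ℝ⟯) : (k.comp (leftTranslation g⁻¹)).comp (leftTranslation g) = k := by
      ext x; exact congrArg k (inv_mul_cancel_left g x)
    simp only [hl, mul_inv_cancel, hone] at hm
    exact eq_neg_of_add_eq_zero_left hm.symm
  change T (fun i => (f i).comp inversionMap) = _
  rw [hinv, T.map_smul_univ (fun _ => (-1 : ℝ)) h, hmul]
  obtain ⟨m, rfl⟩ : ∃ m, n = m + 1 := ⟨n - 1, by omega⟩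
  simp [pow_succ]
end
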